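/- arXiv:1006.3925 — 3 statements merged into one kernel-verified Lean document; each statement's English description precedes it below -/
import Mathlib

section
/- For every target point X₁=(x₁,y₁,θ₁,0) ∈ ℝ²×S¹×ℝ there exists an admissible trajectory (x̄,ȳ,θ̄,κ̄) on some interval [0,T̄], with associated control ū, steering X₀=(0,0,π/2,0) to X₁ and minimizing the cost C(u,T) among all admissible trajectories steering X₀ to X₁ (over all final times T>0). -/
open MeasureTheory Real Set

noncomputable section

/-- Distance between two angles, computed modulo `2π`, with values in `[0, π]`. -/
def angleDist (a b : ℝ) : ℝ := ‖((a - b : ℝ) : Real.Angle)‖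

/-- Hypothesis (H1): `φ` and `ψ` are nonnegative, `C²`, even, nondecreasing on `[0,∞)`,
and vanish at `0`. -/
def H1 (φ ψ : ℝ → ℝ) : Prop :=
  (∀ r, 0 ≤ φ r) ∧ (∀ r, 0 ≤ ψ r) ∧
  ContDiff ℝ 2 φ ∧ ContDiff ℝ 2 ψ ∧
  (∀ r, φ (-r) = φ r) ∧ (∀ r, ψ (-r) = ψ r) ∧
  MonotoneOn φ (Set.Ici 0) ∧ MonotoneOn ψ (Set.Ici 0) ∧
  φ 0 = 0 ∧ ψ 0 = 0

/-- Hypothesis (H2): `ψ` is strictly convex with `ψ''(0) > 0`. -/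
def H2 (ψ : ℝ → ℝ) : Prop :=
  StrictConvexOn ℝ Set.univ ψ ∧ 0 < iteratedDeriv 2 ψ 0

/-- Hypothesis (H3): superlinear growth `ψ(r) ≥ C₀ |r|^p` for `|r| ≥ R₀`. -/
def H3 (ψ : ℝ → ℝ) (p C₀ R₀ : ℝ) : Prop :=
  1 < p ∧ 0 < C₀ ∧ 0 < R₀ ∧ ∀ r : ℝ, R₀ ≤ |r| → C₀ * |r| ^ p ≤ ψ r

/-- An admissible trajectory of the control system `x' = cos θ`, `y' = sin θ`,
`θ' = κ`, `κ' = u` on `[0, T]` steering `W₀` to `W₁`, with control `u ∈ L^p`;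
the final angle is prescribed modulo `2π`. -/
def Connects (p : ℝ) (x y θ κ u : ℝ → ℝ) (T : ℝ)
    (W₀ W₁ : ℝ × ℝ × ℝ × ℝ) : Prop :=
  0 < T ∧ Measurable u ∧
  IntegrableOn (fun t => |u t| ^ p) (Set.Icc 0 T) ∧
  x 0 = W₀.1 ∧ y 0 = W₀.2.1 ∧ θ 0 = W₀.2.2.1 ∧ κ 0 = W₀.2.2.2 ∧
  (∀ t ∈ Set.Icc (0:ℝ) T, x t = x 0 + ∫ s in (0:ℝ)..t, Real.cos (θ s)) ∧
  (∀ t ∈ Set.Icc (0:ℝ) T, y t = y 0 + ∫ s in (0:ℝ)..t, Real.sin (θ s)) ∧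
  (∀ t ∈ Set.Icc (0:ℝ) T, θ t = θ 0 + ∫ s in (0:ℝ)..t, κ s) ∧
  (∀ t ∈ Set.Icc (0:ℝ) T, κ t = κ 0 + ∫ s in (0:ℝ)..t, u s) ∧
  x T = W₁.1 ∧ y T = W₁.2.1 ∧ (∃ k : ℤ, θ T = W₁.2.2.1 + 2 * π * (k : ℝ)) ∧
  κ T = W₁.2.2.2

/-- The cost `C(u,T) = ∫₀ᵀ (1 + φ(κ(t)) + ψ(u(t))) dt`. -/
def cost (φ ψ κ u : ℝ → ℝ) (T : ℝ) : ℝ :=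
  ∫ t in (0:ℝ)..T, (1 + φ (κ t) + ψ (u t))

/-- Optimality: the trajectory is admissible and minimizes the cost among all
admissible trajectories steering `W₀` to `W₁`, over all final times. -/
def IsOptimal (φ ψ : ℝ → ℝ) (p : ℝ) (x y θ κ u : ℝ → ℝ) (T : ℝ)
    (W₀ W₁ : ℝ × ℝ × ℝ × ℝ) : Prop :=
  Connects p x y θ κ u T W₀ W₁ ∧
  ∀ x' y' θ' κ' u' : ℝ → ℝ, ∀ T' : ℝ, Connects p x' y' θ' κ' u' T' W₀ W₁ →
    cost φ ψ κ u T ≤ cost φ ψ κ' u' T'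

/-- The initial point `X₀ = (0, 0, π/2, 0)`. -/
def Xinit : ℝ × ℝ × ℝ × ℝ := (0, 0, π/2, 0)

/-- The constant `C_{φ,ψ} = 8√π (2 + ψ(1) + sup_{s∈[0,√(5π)]} φ(s))`. -/
def Cconst (φ ψ : ℝ → ℝ) : ℝ :=
  8 * Real.sqrt π * (2 + ψ 1 + sSup (φ '' Set.Icc 0 (Real.sqrt (5*π))))

/-- PMP adjoint data `(ρ, φ̂, p₃, p₄)` along a trajectory. -/
def PMPData (φ ψ : ℝ → ℝ) (θ κ u : ℝ → ℝ) (T ρ φh : ℝ) (p₃ p₄ : ℝ → ℝ) : Prop :=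
  0 < ρ ∧ φh ∈ Set.Ico 0 (2*π) ∧
  (∀ t ∈ Set.Icc (0:ℝ) T, p₃ t = p₃ 0 + ∫ s in (0:ℝ)..t, ρ * Real.sin (θ s - φh)) ∧
  (∀ t ∈ Set.Icc (0:ℝ) T, p₄ t = p₄ 0 + ∫ s in (0:ℝ)..t, (-(p₃ s) + deriv φ (κ s))) ∧
  (∀ᵐ t ∂(volume.restrict (Set.Icc (0:ℝ) T)), deriv ψ (u t) = p₄ t) ∧
  (∀ᵐ t ∂(volume.restrict (Set.Icc (0:ℝ) T)),
    ρ * Real.cos (θ t - φh) + p₃ t * κ t + p₄ t * u t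
      - (1 + φ (κ t) + ψ (u t)) = 0)

open Filter Topology

/-- The primitive of `v` vanishing at `0`: the curvature produced by the control `v`. -/
def curv (v : ℝ → ℝ) (t : ℝ) : ℝ := ∫ s in (0:ℝ)..t, v s

/-- The angle produced by the curvature `κ` from the initial angle `π / 2`. -/
def heading (κ : ℝ → ℝ) (t : ℝ) : ℝ := π / 2 + ∫ s in (0:ℝ)..t, κ s

/-- The curvature `κ` drives the initial point to `(x₁, y₁, θ₁, 0)` at time `T`. -/
def Hits (x₁ y₁ θ₁ T : ℝ) (κ : ℝ → ℝ) : Prop :=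
  κ T = 0 ∧ (∫ s in (0:ℝ)..T, cos (heading κ s)) = x₁ ∧
  (∫ s in (0:ℝ)..T, sin (heading κ s)) = y₁ ∧ ((heading κ T : ℝ) : Real.Angle) = (θ₁ : Real.Angle)

/-- Controls of finite cost steering to the target at time `T`, extended by `0` off `[0, T]`. -/
def Competitor (ψ : ℝ → ℝ) (x₁ y₁ θ₁ : ℝ) (v : ℝ → ℝ) (T : ℝ) : Prop :=
  0 < T ∧ Measurable v ∧ (∀ t, t ∉ Set.Icc 0 T → v t = 0) ∧ Integrable (fun t => ψ (v t)) ∧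
  Hits x₁ y₁ θ₁ T (curv v)

/-- The cost of a control that has been extended by `0`. -/
def energy (φ ψ v : ℝ → ℝ) (T : ℝ) : ℝ :=
  T + (∫ t in (0:ℝ)..T, φ (curv v t)) + ∫ t, ψ (v t)

/-- Superlinear growth. -/
def Superlinear (ψ : ℝ → ℝ) : Prop :=
  ∀ ε > 0, ∃ K, 0 ≤ K ∧ ∀ r, |r| ≤ K + ε * ψ r

theorem H3.superlinear {ψ : ℝ → ℝ} {p C₀ R₀ : ℝ} (h0 : ∀ r, 0 ≤ ψ r) (h : H3 ψ p C₀ R₀) :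
    Superlinear ψ := by
  obtain ⟨hp, hC, hR, hg⟩ := h
  intro ε hε
  have ht : Tendsto (fun K : ℝ => C₀ * ε * K ^ (p - 1)) atTop atTop :=
    (tendsto_rpow_atTop (by linarith)).const_mul_atTop (by positivity)
  obtain ⟨K, hK1, hK2⟩ := ((ht.eventually_ge_atTop 1).and (eventually_ge_atTop R₀)).exists
  have hK0 : 0 < K := by linarith
  refine ⟨K, hK0.le, fun r => ?_⟩
  have := mul_nonneg hε.le (h0 r)
  rcases le_total |r| K with h | h
  · linarith
  have hr : 0 < |r| := by linarith
  have h1 := hg r (by linarith)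
  have h2 : |r| ^ p = |r| ^ (p - 1) * |r| := by
    nth_rewrite 3 [← Real.rpow_one |r|]
    rw [← Real.rpow_add hr]; ring_nf
  have h3 : K ^ (p - 1) ≤ |r| ^ (p - 1) := Real.rpow_le_rpow hK0.le h (by linarith)
  have h4 : 1 ≤ C₀ * ε * |r| ^ (p - 1) := hK1.trans (by gcongr)
  have h5 : |r| ≤ ε * (C₀ * |r| ^ p) := by
    rw [h2]; nlinarith
  have h6 : ε * (C₀ * |r| ^ p) ≤ ε * ψ r := by gcongr
  linarith

theorem Superlinear.integrable {ψ v : ℝ → ℝ} {μ : Measure ℝ} [IsFiniteMeasure μ]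
    (hs : Superlinear ψ) (hv : Measurable v) (hi : Integrable (fun t => ψ (v t)) μ) :
    Integrable v μ := by
  obtain ⟨K, -, hK⟩ := hs 1 one_pos
  refine Integrable.mono' ((integrable_const K).add hi) hv.aestronglyMeasurable ?_
  filter_upwards with t
  simpa using hK (v t)

theorem Superlinear.intervalIntegrable {ψ v : ℝ → ℝ} (hs : Superlinear ψ) (hv : Measurable v)
    (hi : Integrable (fun t => ψ (v t))) (a b : ℝ) : IntervalIntegrable v volume a b := by
  rw [intervalIntegrable_iff, IntegrableOn]
  have : IsFiniteMeasure (volume.restrict (Set.uIoc a b)) := by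
    constructor; simp [Set.uIoc]
  exact hs.integrable hv hi.integrableOn

theorem abs_curv_sub_le {ψ v : ℝ → ℝ} (hs : Superlinear ψ) (hv : Measurable v)
    (hi : Integrable (fun t => ψ (v t))) {K ε : ℝ} (hK : ∀ r, |r| ≤ K + ε * ψ r) {a b : ℝ} :
    |curv v b - curv v a| ≤ K * |b - a| + ε * ∫ t in Set.uIoc a b, ψ (v t) := by
  have hii := hs.intervalIntegrable hv hi
  unfold curv
  rw [intervalIntegral.integral_interval_sub_left (hii _ _) (hii _ _), ← Real.norm_eq_abs]
  refine (intervalIntegral.norm_integral_le_integral_norm_uIoc).trans ?_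
  have h1 : IntegrableOn (fun _ : ℝ => K) (Set.uIoc a b) := by
    exact integrableOn_const (by simp [Set.uIoc]) (by simp)
  have h2 : IntegrableOn (fun t => ε * ψ (v t)) (Set.uIoc a b) := (hi.const_mul ε).integrableOn
  calc _ ≤ ∫ t in Set.uIoc a b, (K + ε * ψ (v t)) := by
        refine integral_mono (intervalIntegrable_iff.1 (hii a b)).norm (h1.add h2) fun t => ?_
        simpa using hK (v t)
    _ = _ := by
        rw [integral_add h1 h2, integral_const_mul]
        simp [Set.uIoc, Measure.real, max_sub_min_eq_abs, mul_comm]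

theorem abs_curv_sub_le' {ψ v : ℝ → ℝ} (hs : Superlinear ψ) (hψ : ∀ r, 0 ≤ ψ r) (hv : Measurable v)
    (hi : Integrable (fun t => ψ (v t))) {K ε B : ℝ} (hε : 0 ≤ ε) (hK : ∀ r, |r| ≤ K + ε * ψ r)
    (hB : ∫ t, ψ (v t) ≤ B) (a b : ℝ) :
    |curv v b - curv v a| ≤ K * |b - a| + ε * B := by
  refine (abs_curv_sub_le hs hv hi hK).trans ?_
  gcongr
  exact (setIntegral_le_integral hi (Eventually.of_forall fun t => hψ _)).trans hB

theorem curv_continuous {ψ v : ℝ → ℝ} (hs : Superlinear ψ) (hv : Measurable v)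
    (hi : Integrable (fun t => ψ (v t))) : Continuous (curv v) :=
  intervalIntegral.continuous_primitive (hs.intervalIntegrable hv hi) 0

theorem curv_projIcc {v : ℝ → ℝ} {S : ℝ} (hS : 0 ≤ S) (hv : ∀ t, t ∉ Set.Icc 0 S → v t = 0)
    (t : ℝ) : curv v (Set.projIcc 0 S hS t) = curv v t := by
  unfold curv
  rcases le_total t 0 with h | h
  · rw [Set.projIcc_of_le_left _ h, intervalIntegral.integral_same, intervalIntegral.integral_symm,
      eq_comm, neg_eq_zero, intervalIntegral.integral_of_le h, integral_Ioc_eq_integral_Ioo]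
    exact setIntegral_eq_zero_of_forall_eq_zero fun s hs => hv s fun h' => by
      have := hs.2; have := h'.1; linarith
  rcases le_total S t with h' | h'
  · rw [Set.projIcc_of_right_le _ h']
    simp only
    rw [intervalIntegral.integral_of_le hS, intervalIntegral.integral_of_le h]
    exact (setIntegral_eq_of_subset_of_forall_sdiff_eq_zero measurableSet_Ioc
      (Set.Ioc_subset_Ioc_right h') fun s hs => hv s fun h2 => hs.2 ⟨hs.1.1, h2.2⟩).symm
  · rw [Set.projIcc_of_mem _ ⟨h, h'⟩]

theorem exists_subseq_curv {ψ : ℝ → ℝ} (hs : Superlinear ψ) (hψ : ∀ r, 0 ≤ ψ r) {S B : ℝ}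
    (hS : 0 ≤ S) {v : ℕ → ℝ → ℝ} (hv : ∀ n, Measurable (v n))
    (hsupp : ∀ n t, t ∉ Set.Icc 0 S → v n t = 0) (hi : ∀ n, Integrable (fun t => ψ (v n t)))
    (hB : ∀ n, ∫ t, ψ (v n t) ≤ B) :
    ∃ (κ : ℝ → ℝ) (g : ℕ → ℕ), StrictMono g ∧ Continuous κ ∧
      TendstoUniformly (fun n => curv (v (g n))) κ atTop := by
  have hB0 : 0 ≤ B := (integral_nonneg fun t => hψ _).trans (hB 0)
  let f : ℕ → BoundedContinuousFunction (Set.Icc 0 S) ℝ := fun n =>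
    BoundedContinuousFunction.mkOfCompact
      ⟨fun t => curv (v n) t, (curv_continuous hs (hv n) (hi n)).comp continuous_subtype_val⟩
  obtain ⟨K₁, hK₁, hK₁'⟩ := hs 1 one_pos
  have hcomp : IsCompact (closure (Set.range f)) := by
    refine BoundedContinuousFunction.arzela_ascoli (Metric.closedBall (0:ℝ) (K₁ * S + 1 * B))
      (isCompact_closedBall _ _) _ ?_ ?_
    · rintro _ t ⟨n, rfl⟩
      have := abs_curv_sub_le' hs hψ (hv n) (hi n) zero_le_one hK₁' (hB n) 0 t
      have h0 : curv (v n) 0 = 0 := by simp [curv]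
      rw [h0, sub_zero, sub_zero, abs_of_nonneg t.2.1] at this
      have h1 := t.2.2
      rw [mem_closedBall_zero_iff, Real.norm_eq_abs]
      refine this.trans ?_
      gcongr
    · intro x
      rw [Metric.equicontinuousAt_iff]
      intro ε hε
      obtain ⟨K, hK0, hK⟩ := hs (ε / (2 * (B + 1))) (by positivity)
      refine ⟨ε / (2 * (K + 1)), by positivity, ?_⟩
      rintro t ht ⟨_, n, rfl⟩
      have := abs_curv_sub_le' hs hψ (hv n) (hi n) (by positivity) hK (hB n) t x
      change |curv (v n) x - curv (v n) t| < ε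
      rw [Subtype.dist_eq, dist_comm, Real.dist_eq] at ht
      refine this.trans_lt ?_
      have h1 : K * |(x:ℝ) - t| ≤ ε / 2 := by
        calc K * |(x:ℝ) - t| ≤ (K + 1) * (ε / (2 * (K + 1))) := by
              gcongr; linarith
          _ = ε / 2 := by field_simp
      have h2 : ε / (2 * (B + 1)) * B < ε / 2 := by
        rw [div_mul_eq_mul_div, div_lt_div_iff₀ (by positivity) (by positivity)]
        nlinarith
      linarith
  obtain ⟨F, -, g, hg, hF⟩ := hcomp.tendsto_subseq (fun n => subset_closure (Set.mem_range_self n))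
  refine ⟨fun t => F (Set.projIcc 0 S hS t), g, hg, F.continuous.comp continuous_projIcc, ?_⟩
  rw [BoundedContinuousFunction.tendsto_iff_tendstoUniformly] at hF
  convert! hF.comp (Set.projIcc 0 S hS) using 2
  funext t
  exact (curv_projIcc hS (hsupp _) t).symm

theorem absolutelyContinuous_of_tendsto {ψ : ℝ → ℝ} (hs : Superlinear ψ) (hψ : ∀ r, 0 ≤ ψ r)
    {B : ℝ} {v : ℕ → ℝ → ℝ} (hv : ∀ n, Measurable (v n))
    (hi : ∀ n, Integrable (fun t => ψ (v n t))) (hB : ∀ n, ∫ t, ψ (v n t) ≤ B) {κ : ℝ → ℝ}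
    (hκ : ∀ t, Tendsto (fun n => curv (v n) t) atTop (𝓝 (κ t))) (a b : ℝ) :
    AbsolutelyContinuousOnInterval κ a b := by
  have hB0 : 0 ≤ B := (integral_nonneg fun t => hψ _).trans (hB 0)
  rw [absolutelyContinuousOnInterval_iff]
  intro ε hε
  obtain ⟨K, hK0, hK⟩ := hs (ε / (4 * (B + 1))) (by positivity)
  refine ⟨ε / (4 * (K + 1)), by positivity, ?_⟩
  rintro ⟨N, I⟩ ⟨-, hd⟩ hlt
  simp only at hd hlt ⊢
  have hlim : Tendsto (fun n => ∑ i ∈ Finset.range N,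
      dist (curv (v n) (I i).1) (curv (v n) (I i).2)) atTop
      (𝓝 (∑ i ∈ Finset.range N, dist (κ (I i).1) (κ (I i).2))) :=
    tendsto_finsetSum _ fun i _ => (hκ _).dist (hκ _)
  refine (le_of_tendsto' hlim (b := ε / 2) fun n => ?_).trans_lt (by linarith)
  calc ∑ i ∈ Finset.range N, dist (curv (v n) (I i).1) (curv (v n) (I i).2)
      ≤ ∑ i ∈ Finset.range N, (K * dist (I i).1 (I i).2 + ε / (4 * (B + 1)) *
          ∫ t in Set.uIoc (I i).1 (I i).2, ψ (v n t)) := by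
        refine Finset.sum_le_sum fun i _ => ?_
        rw [dist_comm, Real.dist_eq, dist_comm, Real.dist_eq]
        exact abs_curv_sub_le hs (hv n) (hi n) hK
    _ = K * ∑ i ∈ Finset.range N, dist (I i).1 (I i).2 + ε / (4 * (B + 1)) *
          ∫ t in ⋃ i ∈ Finset.range N, Set.uIoc (I i).1 (I i).2, ψ (v n t) := by
        rw [Finset.sum_add_distrib, ← Finset.mul_sum, ← Finset.mul_sum,
          integral_biUnion_finset _ (fun i _ => measurableSet_uIoc) hd
            (fun i _ => (hi n).integrableOn)]
    _ ≤ (K + 1) * (ε / (4 * (K + 1))) + ε / (4 * (B + 1)) * (B + 1) := by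
        gcongr
        · linarith
        · have := (setIntegral_le_integral
            (s := ⋃ i ∈ Finset.range N, Set.uIoc (I i).1 (I i).2) (hi n)
            (Eventually.of_forall fun t => hψ _)).trans (hB n)
          linarith
    _ = ε / 2 := by field_simp; ring

theorem map_slope_curv_le {ψ v : ℝ → ℝ} (hs : Superlinear ψ) (hc : ConvexOn ℝ Set.univ ψ)
    (hψc : Continuous ψ) (hv : Measurable v) (hi : Integrable (fun t => ψ (v t))) {h : ℝ}
    (hh : 0 < h) (t : ℝ) :
    ψ ((curv v (t + h) - curv v t) / h) ≤
      (curv (fun s => ψ (v s)) (t + h) - curv (fun s => ψ (v s)) t) / h := by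
  have hii := hs.intervalIntegrable hv hi
  have hle : t ≤ t + h := by linarith
  have hj := hc.map_set_average_le hψc.continuousOn isClosed_univ (μ := volume)
    (t := Set.Ioc t (t + h)) (f := v) (by simp [hh]) (by simp) (by simp)
    ((intervalIntegrable_iff_integrableOn_Ioc_of_le hle).1 (hii _ _)) hi.integrableOn
  rw [setAverage_eq, setAverage_eq] at hj
  unfold curv
  rw [intervalIntegral.integral_interval_sub_left (hii _ _) (hii _ _),
    intervalIntegral.integral_interval_sub_left hi.intervalIntegrable hi.intervalIntegrable,
    intervalIntegral.integral_of_le hle, intervalIntegral.integral_of_le hle]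
  simpa [Measure.real, hh.le, div_eq_inv_mul] using hj

theorem integral_sub_shift_le {G : ℝ → ℝ} (hG : Continuous G) {B h S : ℝ} (hh : 0 < h)
    (h0 : ∀ t, 0 ≤ t → 0 ≤ G t) (hB : ∀ t, 0 ≤ t → G t ≤ B) (hS : 0 ≤ S) :
    ∫ t in (0:ℝ)..S, (G (t + h) - G t) / h ≤ B := by
  have hii : ∀ a b, IntervalIntegrable G volume a b := fun a b => hG.intervalIntegrable a b
  have hsh : IntervalIntegrable (fun t => G (t + h)) volume 0 S :=
    Continuous.intervalIntegrable (by fun_prop) _ _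
  rw [intervalIntegral.integral_div, intervalIntegral.integral_sub hsh (hii _ _),
    intervalIntegral.integral_comp_add_right, zero_add, div_le_iff₀ hh,
    intervalIntegral.integral_interval_sub_interval_comm (hii _ _) (hii _ _) (hii _ _)]
  have h1 : 0 ≤ ∫ t in (0:ℝ)..h, G t :=
    intervalIntegral.integral_nonneg hh.le fun t ht => h0 t ht.1
  have h2 : ∫ t in S..(S + h), G t ≤ ∫ _ in S..(S + h), B :=
    intervalIntegral.integral_mono_on (by linarith) (hii _ _) (by simp)
      fun t ht => hB t (hS.trans ht.1)
  rw [intervalIntegral.integral_const] at h2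
  rw [intervalIntegral.integral_symm 0 h, intervalIntegral.integral_symm S (S + h)]
  simp at h2 ⊢
  linarith

theorem lintegral_slope_curv_le {ψ v : ℝ → ℝ} (hs : Superlinear ψ) (hψ : ∀ r, 0 ≤ ψ r)
    (hc : ConvexOn ℝ Set.univ ψ) (hψc : Continuous ψ) (hv : Measurable v)
    (hi : Integrable (fun t => ψ (v t))) {h S : ℝ} (hh : 0 < h) (hS : 0 ≤ S) :
    ∫⁻ t in Set.Ioc 0 S, ENNReal.ofReal (ψ ((curv v (t + h) - curv v t) / h)) ≤
      ENNReal.ofReal (∫ t, ψ (v t)) := by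
  have hcont : Continuous (curv v) := curv_continuous hs hv hi
  have hGcont : Continuous (curv (fun s => ψ (v s))) :=
    intervalIntegral.continuous_primitive (fun a b => hi.intervalIntegrable) 0
  have hf : Continuous fun t => ψ ((curv v (t + h) - curv v t) / h) := by fun_prop
  rw [← ofReal_integral_eq_lintegral_ofReal]
  · refine ENNReal.ofReal_le_ofReal ?_
    rw [← intervalIntegral.integral_of_le hS]
    refine (intervalIntegral.integral_mono_on hS (hf.intervalIntegrable _ _) ?_
      fun t _ => map_slope_curv_le hs hc hψc hv hi hh t).trans
      (integral_sub_shift_le hGcont hh ?_ ?_ hS)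
    · exact Continuous.intervalIntegrable (by fun_prop) _ _
    · exact fun t ht => intervalIntegral.integral_nonneg ht fun s _ => hψ _
    · intro t ht
      unfold curv
      rw [intervalIntegral.integral_of_le ht]
      exact setIntegral_le_integral hi (Eventually.of_forall fun t => hψ _)
  · exact (hf.integrableOn_Icc).mono_set Set.Ioc_subset_Icc_self
  · exact Eventually.of_forall fun t => hψ _

/-- Lower semicontinuity of the control cost along pointwise convergent curvatures. -/
theorem lintegral_deriv_le_of_tendsto {ψ : ℝ → ℝ} (hs : Superlinear ψ) (hψ : ∀ r, 0 ≤ ψ r)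
    (hc : ConvexOn ℝ Set.univ ψ) (hψc : Continuous ψ) {v : ℕ → ℝ → ℝ} (hv : ∀ n, Measurable (v n))
    (hi : ∀ n, Integrable (fun t => ψ (v n t))) {b S : ℝ} (hS : 0 ≤ S)
    (hb : Tendsto (fun n => ∫ t, ψ (v n t)) atTop (𝓝 b)) {κ : ℝ → ℝ} (hκc : Continuous κ)
    (hκ : ∀ t, Tendsto (fun n => curv (v n) t) atTop (𝓝 (κ t)))
    (hd : ∀ᵐ t, t ∈ Set.uIcc 0 S → DifferentiableAt ℝ κ t) :
    ∫⁻ t in Set.Ioc 0 S, ENNReal.ofReal (ψ (deriv κ t)) ≤ ENNReal.ofReal b := by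
  have hmeas : Continuous fun r => ENNReal.ofReal (ψ r) := ENNReal.continuous_ofReal.comp hψc
  have hstep : ∀ h : ℝ, 0 < h →
      ∫⁻ t in Set.Ioc 0 S, ENNReal.ofReal (ψ ((κ (t + h) - κ t) / h)) ≤ ENNReal.ofReal b := by
    intro h hh
    calc _ = ∫⁻ t in Set.Ioc 0 S, liminf (fun n =>
            ENNReal.ofReal (ψ ((curv (v n) (t + h) - curv (v n) t) / h))) atTop := by
          refine lintegral_congr fun t => Eq.symm (Tendsto.liminf_eq ?_)
          exact (hmeas.tendsto _).comp (((hκ (t + h)).sub (hκ t)).div_const h)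
      _ ≤ liminf (fun n => ∫⁻ t in Set.Ioc 0 S,
            ENNReal.ofReal (ψ ((curv (v n) (t + h) - curv (v n) t) / h))) atTop := by
          refine lintegral_liminf_le fun n => ?_
          have := curv_continuous hs (hv n) (hi n)
          exact (hmeas.comp (by fun_prop :
            Continuous fun t => (curv (v n) (t + h) - curv (v n) t) / h)).measurable
      _ ≤ liminf (fun n => ENNReal.ofReal (∫ t, ψ (v n t))) atTop :=
          liminf_le_liminf (Eventually.of_forall fun n =>
            lintegral_slope_curv_le hs hψ hc hψc (hv n) (hi n) hh hS)
      _ = ENNReal.ofReal b := ((ENNReal.continuous_ofReal.tendsto _).comp hb).liminf_eq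
  let h : ℕ → ℝ := fun j => 1 / ((j : ℝ) + 1)
  have hpos : ∀ j, 0 < h j := fun j => Nat.one_div_pos_of_nat
  have hh0 : Tendsto h atTop (𝓝[≠] 0) :=
    tendsto_nhdsWithin_of_tendsto_nhds_of_eventually_within _
      tendsto_one_div_add_atTop_nhds_zero_nat (Eventually.of_forall fun j => (hpos j).ne')
  calc _ = ∫⁻ t in Set.Ioc 0 S, liminf (fun j =>
          ENNReal.ofReal (ψ ((κ (t + h j) - κ t) / h j))) atTop := by
        refine lintegral_congr_ae ?_
        filter_upwards [ae_restrict_of_ae hd, ae_restrict_mem measurableSet_Ioc] with t ht htm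
        have hdt := (ht (Set.uIcc_of_le hS ▸ Set.Ioc_subset_Icc_self htm)).hasDerivAt
        refine Eq.symm (Tendsto.liminf_eq ?_)
        refine (hmeas.tendsto _).comp ?_
        simpa [div_eq_inv_mul] using! hdt.tendsto_slope_zero.comp hh0
    _ ≤ liminf (fun j => ∫⁻ t in Set.Ioc 0 S,
          ENNReal.ofReal (ψ ((κ (t + h j) - κ t) / h j))) atTop :=
        lintegral_liminf_le fun j => (hmeas.comp (by fun_prop :
            Continuous fun t => (κ (t + h j) - κ t) / h j)).measurable
    _ ≤ liminf (fun _ => ENNReal.ofReal b) atTop :=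
        liminf_le_liminf (Eventually.of_forall fun j => hstep _ (hpos j))
    _ = ENNReal.ofReal b := liminf_const _

/-- The heading can be changed smoothly from `α` to `β` in positive time, starting and ending with
constant heading, with total displacement `(X, Y)`. -/
def Steers (α β X Y : ℝ) : Prop :=
  ∃ (T : ℝ) (f : ℝ → ℝ), 0 < T ∧ ContDiff ℝ 2 f ∧ (∀ t ≤ 0, f t = α) ∧ (∀ t, T ≤ t → f t = β) ∧
    (∫ t in (0:ℝ)..T, cos (f t)) = X ∧ (∫ t in (0:ℝ)..T, sin (f t)) = Y

theorem Steers.straight (α : ℝ) {l : ℝ} (hl : 0 < l) : Steers α α (l * cos α) (l * sin α) :=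
  ⟨l, fun _ => α, hl, contDiff_const, fun _ _ => rfl, fun _ _ => rfl, by simp, by simp⟩

theorem exists_steers (α β : ℝ) : ∃ X Y, Steers α β X Y := by
  refine ⟨_, _, 1, fun t => α + (β - α) * Real.smoothTransition t, one_pos, ?_, ?_, ?_, rfl, rfl⟩
  · exact contDiff_const.add (contDiff_const.mul Real.smoothTransition.contDiff)
  · intro t ht
    simp [Real.smoothTransition.zero_of_nonpos ht]
  · intro t ht
    simp [Real.smoothTransition.one_of_one_le ht]

theorem Steers.trans {α β γ X Y X' Y' : ℝ} (h : Steers α β X Y) (h' : Steers β γ X' Y') :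
    Steers α γ (X + X') (Y + Y') := by
  obtain ⟨T, f, hT, hf, hf0, hf1, rfl, rfl⟩ := h
  obtain ⟨T', g, hT', hg, hg0, hg1, rfl, rfl⟩ := h'
  have hleft : ∀ t ≤ T, f t + g (t - T) - β = f t := fun t ht => by
    rw [hg0 _ (by linarith)]; ring
  have hright : ∀ t, T ≤ t → f t + g (t - T) - β = g (t - T) := fun t ht => by
    rw [hf1 _ ht]; ring
  have hcont : Continuous fun t => f t + g (t - T) - β := by
    have := hf.continuous
    have := hg.continuous
    fun_prop
  have key : ∀ c : ℝ → ℝ, Continuous c →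
      ∫ t in (0:ℝ)..(T + T'), c (f t + g (t - T) - β) =
        (∫ t in (0:ℝ)..T, c (f t)) + ∫ t in (0:ℝ)..T', c (g t) := by
    intro c hc
    have hci : ∀ a b, IntervalIntegrable (fun t => c (f t + g (t - T) - β)) volume a b :=
      fun a b => (hc.comp hcont).intervalIntegrable a b
    rw [← intervalIntegral.integral_add_adjacent_intervals (hci 0 T) (hci T (T + T'))]
    congr 1
    · refine intervalIntegral.integral_congr fun t ht => ?_
      rw [Set.uIcc_of_le hT.le] at ht
      simp only [hleft t ht.2]
    · have := intervalIntegral.integral_comp_sub_right (fun t => c (g t)) T (a := T) (b := T + T')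
      rw [sub_self, add_sub_cancel_left] at this
      rw [← this]
      refine intervalIntegral.integral_congr fun t ht => ?_
      rw [Set.uIcc_of_le (by linarith)] at ht
      simp only [hright t ht.1]
  refine ⟨T + T', fun t => f t + g (t - T) - β, by linarith, ?_, ?_, ?_, key _ continuous_cos,
    key _ continuous_sin⟩
  · exact (hf.add (hg.comp (contDiff_id.sub contDiff_const))).sub contDiff_const
  · intro t ht
    exact (hleft t (by linarith)).trans (hf0 t ht)
  · intro t ht
    exact (hright t (by linarith)).trans (hg1 _ (by linarith))

theorem steers_any (α β X Y : ℝ) : Steers α β X Y := by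
  obtain ⟨A₁, B₁, t₁⟩ := exists_steers α 0
  obtain ⟨A₂, B₂, t₂⟩ := exists_steers 0 (π / 2)
  obtain ⟨A₃, B₃, t₃⟩ := exists_steers (π / 2) π
  obtain ⟨A₄, B₄, t₄⟩ := exists_steers π (-(π / 2))
  obtain ⟨A₅, B₅, t₅⟩ := exists_steers (-(π / 2)) β
  set P := X - (A₁ + A₂ + A₃ + A₄ + A₅) with hP
  set Q := Y - (B₁ + B₂ + B₃ + B₄ + B₅) with hQ
  have pos : ∀ r : ℝ, 0 < max r 0 + 1 := fun r => by positivity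
  have diff : ∀ r : ℝ, (max r 0 + 1) - (max (-r) 0 + 1) = r := fun r => by
    rcases le_total r 0 with h | h <;> simp [h]
  have := (((((((t₁.trans (.straight 0 (pos P))).trans t₂).trans
    (.straight (π / 2) (pos Q))).trans t₃).trans (.straight π (pos (-P)))).trans t₄).trans
    (.straight (-(π / 2)) (pos (-Q)))).trans t₅
  have dP := diff P
  have dQ := diff Q
  convert this using 1
  · simp only [cos_zero, cos_pi_div_two, cos_pi, cos_neg]
    linarith
  · simp only [sin_zero, sin_pi_div_two, sin_pi, sin_neg]
    linarith

theorem deriv_eq_zero_of_eqOn_const {f : ℝ → ℝ} {s : Set ℝ} {t c : ℝ} (hf : DifferentiableAt ℝ f t)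
    (hs : UniqueDiffWithinAt ℝ s t) (ht : t ∈ s) (h : ∀ r ∈ s, f r = c) : deriv f t = 0 :=
  hs.eq_deriv s hf.hasDerivAt.hasDerivWithinAt
    ((hasDerivWithinAt_const t s c).congr h (h t ht))

theorem exists_connects {p : ℝ} (hp : 0 ≤ p) (x₁ y₁ θ₁ : ℝ) :
    ∃ (x y θ κ u : ℝ → ℝ) (T : ℝ), Connects p x y θ κ u T Xinit (x₁, y₁, θ₁, 0) := by
  obtain ⟨T, f, hT, hf, hf0, hf1, hx, hy⟩ := steers_any (π / 2) θ₁ x₁ y₁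
  have hd : ContDiff ℝ 1 (deriv f) := hf.deriv' (n := 1)
  have hdc : Continuous (deriv f) := hd.continuous
  have hu : Continuous (deriv (deriv f)) := hd.continuous_deriv le_rfl
  have hdiff : Differentiable ℝ f := hf.differentiable (by norm_num)
  have hdiff' : Differentiable ℝ (deriv f) := hd.differentiable (by norm_num)
  refine ⟨fun t => ∫ s in (0:ℝ)..t, cos (f s), fun t => ∫ s in (0:ℝ)..t, sin (f s), f, deriv f,
    deriv (deriv f), T, hT, hu.measurable, ?_, ?_, ?_, ?_, ?_, ?_, ?_, ?_, ?_, hx, hy, ⟨0, ?_⟩,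
    ?_⟩
  · exact (hu.abs.rpow_const fun _ => Or.inr hp).integrableOn_Icc
  · simp [Xinit]
  · simp [Xinit]
  · exact hf0 0 le_rfl
  · exact deriv_eq_zero_of_eqOn_const (hdiff 0) (uniqueDiffWithinAt_Iic 0) Set.self_mem_Iic hf0
  · intro t _; simp
  · intro t _; simp
  · intro t _
    rw [intervalIntegral.integral_deriv_eq_sub (fun s _ => hdiff s) (hdc.intervalIntegrable _ _)]
    ring
  · intro t _
    rw [intervalIntegral.integral_deriv_eq_sub (fun s _ => hdiff' s) (hu.intervalIntegrable _ _)]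
    ring
  · simpa using hf1 T le_rfl
  · exact deriv_eq_zero_of_eqOn_const (hdiff T) (uniqueDiffWithinAt_Ici T) Set.self_mem_Ici hf1

theorem heading_continuous {κ : ℝ → ℝ} (hκ : Continuous κ) : Continuous (heading κ) :=
  continuous_const.add
    (intervalIntegral.continuous_primitive (fun a b => hκ.intervalIntegrable a b) 0)

theorem Connects.competitor {φ ψ : ℝ → ℝ} {p x₁ y₁ θ₁ T : ℝ} {x y θ κ u : ℝ → ℝ}
    (hφ : ∀ r, 0 ≤ φ r) (hφc : Continuous φ) (hψ : ∀ r, 0 ≤ ψ r) (hψc : Continuous ψ)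
    (hψ0 : ψ 0 = 0) (hs : Superlinear ψ)
    (h : Connects p x y θ κ u T Xinit (x₁, y₁, θ₁, 0))
    (hi : IntervalIntegrable (fun t => 1 + φ (κ t) + ψ (u t)) volume 0 T) :
    ∃ v, Competitor ψ x₁ y₁ θ₁ v T ∧ energy φ ψ v T = cost φ ψ κ u T := by
  obtain ⟨hT, hu, -, hx0, hy0, hθ0, hκ0, hx, hy, hθ, hκ, hxT, hyT, ⟨k, hk⟩, hκT⟩ := h
  simp only [Xinit] at hx0 hy0 hθ0 hκ0 hxT hyT hk hκT
  have hψu : IntegrableOn (fun t => ψ (u t)) (Set.Icc 0 T) := by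
    rw [intervalIntegrable_iff_integrableOn_Icc_of_le hT.le] at hi
    refine Integrable.mono' hi (hψc.measurable.comp hu).aestronglyMeasurable ?_
    filter_upwards with t
    rw [Real.norm_eq_abs, abs_of_nonneg (hψ _)]
    linarith [hφ (κ t)]
  set v : ℝ → ℝ := (Set.Icc 0 T).indicator u with hvdef
  have hvu : ∀ t ∈ Set.Icc 0 T, v t = u t := fun t ht => Set.indicator_of_mem ht u
  have hv : Measurable v := hu.indicator measurableSet_Icc
  have hψv : (fun t => ψ (v t)) = (Set.Icc 0 T).indicator fun t => ψ (u t) := by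
    funext t
    by_cases ht : t ∈ Set.Icc 0 T <;> simp [hvdef, ht, hψ0]
  have hiv : Integrable (fun t => ψ (v t)) := by
    rw [hψv]
    exact (integrable_indicator_iff measurableSet_Icc).2 hψu
  have hsub : ∀ t ∈ Set.Icc 0 T, ∀ s ∈ Set.uIcc 0 t, s ∈ Set.Icc 0 T := fun t ht s hs' => by
    rw [Set.uIcc_of_le ht.1] at hs'
    exact ⟨hs'.1, hs'.2.trans ht.2⟩
  have hcurv : ∀ t ∈ Set.Icc 0 T, curv v t = κ t := fun t ht => by
    rw [hκ t ht, hκ0, zero_add]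
    exact intervalIntegral.integral_congr fun s hs' => hvu s (hsub t ht s hs')
  have hhead : ∀ t ∈ Set.Icc 0 T, heading (curv v) t = θ t := fun t ht => by
    rw [hθ t ht, hθ0]
    unfold heading
    congr 1
    exact intervalIntegral.integral_congr fun s hs' => hcurv s (hsub t ht s hs')
  have hTm : T ∈ Set.Icc 0 T := ⟨hT.le, le_rfl⟩
  have hccont := curv_continuous hs hv hiv
  refine ⟨v, ⟨hT, hv, fun t ht => Set.indicator_of_notMem ht u, hiv, ?_, ?_, ?_, ?_⟩, ?_⟩
  · rw [hcurv T hTm, hκT]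
  · rw [← hxT, hx T hTm, hx0, zero_add]
    exact intervalIntegral.integral_congr fun s hs' => by
      simp only [hhead s (hsub T hTm s hs')]
  · rw [← hyT, hy T hTm, hy0, zero_add]
    exact intervalIntegral.integral_congr fun s hs' => by
      simp only [hhead s (hsub T hTm s hs')]
  · rw [hhead T hTm, hk, Real.Angle.angle_eq_iff_two_pi_dvd_sub]
    exact ⟨k, by ring⟩
  · have hφi : IntervalIntegrable (fun t => φ (curv v t)) volume 0 T :=
      (hφc.comp hccont).intervalIntegrable _ _
    have h1 : cost φ ψ κ u T = ∫ t in (0:ℝ)..T, (1 + φ (curv v t) + ψ (v t)) :=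
      intervalIntegral.integral_congr fun s hs' => by
        simp only [hcurv s (hsub T hTm s hs'), hvu s (hsub T hTm s hs')]
    have h2 : ∫ t in (0:ℝ)..T, ψ (v t) = ∫ t, ψ (v t) := by
      rw [intervalIntegral.integral_of_le hT.le, ← integral_Icc_eq_integral_Ioc]
      refine setIntegral_eq_integral_of_forall_compl_eq_zero fun t ht => ?_
      rw [hvdef, Set.indicator_of_notMem ht, hψ0]
    rw [h1, intervalIntegral.integral_add (intervalIntegrable_const.add hφi)
      hiv.intervalIntegrable, intervalIntegral.integral_add intervalIntegrable_const hφi, h2]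
    simp [energy]

theorem Hits.connects {ψ : ℝ → ℝ} {p C₀ R₀ x₁ y₁ θ₁ T : ℝ} {κ : ℝ → ℝ} (hψ : ∀ r, 0 ≤ ψ r)
    (h3 : H3 ψ p C₀ R₀) (hT : 0 < T) (h : Hits x₁ y₁ θ₁ T κ) (hκ0 : κ 0 = 0)
    (hac : AbsolutelyContinuousOnInterval κ 0 T)
    (hi : IntegrableOn (fun t => ψ (deriv κ t)) (Set.Icc 0 T)) :
    ∃ x y, Connects p x y (heading κ) κ (deriv κ) T Xinit (x₁, y₁, θ₁, 0) := by
  obtain ⟨hκT, hx, hy, hθ⟩ := h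
  obtain ⟨hp, hC, hR, hg⟩ := h3
  refine ⟨fun t => ∫ s in (0:ℝ)..t, cos (heading κ s), fun t => ∫ s in (0:ℝ)..t, sin (heading κ s),
    hT, measurable_deriv κ, ?_, ?_, ?_, ?_, hκ0, ?_, ?_, ?_, ?_, hx, hy, ?_, hκT⟩
  · have hconst : IntegrableOn (fun _ : ℝ => R₀ ^ p) (Set.Icc 0 T) :=
      integrableOn_const (by simp) (by simp)
    refine Integrable.mono' (hconst.add (hi.const_mul C₀⁻¹))
      ((measurable_deriv κ).abs.pow_const p).aestronglyMeasurable ?_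
    filter_upwards with t
    rw [Real.norm_eq_abs, abs_of_nonneg (by positivity)]
    simp only [Pi.add_apply]
    have h1 : 0 ≤ C₀⁻¹ * ψ (deriv κ t) := mul_nonneg (by positivity) (hψ _)
    have h2 : 0 ≤ R₀ ^ p := by positivity
    rcases le_total R₀ |deriv κ t| with hle | hle
    · have h4 : |deriv κ t| ^ p ≤ C₀⁻¹ * ψ (deriv κ t) := by
        rw [inv_mul_eq_div, le_div_iff₀ hC, mul_comm]
        exact hg _ hle
      linarith
    · have h4 : |deriv κ t| ^ p ≤ R₀ ^ p :=
        Real.rpow_le_rpow (abs_nonneg _) hle (by linarith)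
      linarith
  · simp [Xinit]
  · simp [Xinit]
  · simp [Xinit, heading]
  · intro t _; simp
  · intro t _; simp
  · intro t _; simp [heading]
  · intro t ht
    have hsub : Set.uIcc 0 t ⊆ Set.uIcc 0 T := by
      rw [Set.uIcc_of_le ht.1, Set.uIcc_of_le hT.le]
      exact Set.Icc_subset_Icc_right ht.2
    rw [(hac.mono hsub).integral_deriv_eq_sub]
    ring
  · obtain ⟨k, hk⟩ := Real.Angle.angle_eq_iff_two_pi_dvd_sub.1 hθ
    exact ⟨k, by simp only; linarith⟩

/-- Trajectories of bounded cost need a positive time to reach the target. -/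
theorem exists_pos_le_time {ψ : ℝ → ℝ} (hs : Superlinear ψ) (hψ : ∀ r, 0 ≤ ψ r) {B : ℝ}
    (hB0 : 0 ≤ B) (x₁ y₁ θ₁ : ℝ) :
    ∃ δ > 0, ∀ v T, Competitor ψ x₁ y₁ θ₁ v T → ∫ t, ψ (v t) ≤ B → δ ≤ T := by
  obtain ⟨K, hK0, hK⟩ := hs 1 one_pos
  refine ⟨min (1 / (K + B + 1)) (if 0 < y₁ then y₁ else 1), ?_, ?_⟩
  · refine lt_min (by positivity) ?_
    split_ifs with h
    exacts [h, one_pos]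
  rintro v T ⟨hT, hv, -, hi, -, -, hy, -⟩ hB
  by_contra! hlt
  have hT1 : T * (K + B + 1) < 1 := (lt_div_iff₀ (by positivity)).1 (hlt.trans_le (min_le_left _ _))
  have hT1' : T ≤ 1 := by nlinarith
  have hcont := curv_continuous hs hv hi
  have hhc : Continuous fun t => sin (heading (curv v) t) :=
    continuous_sin.comp (heading_continuous hcont)
  have hsin : ∀ t ∈ Set.Icc 0 T, 1 / 2 ≤ sin (heading (curv v) t) := by
    intro t ht
    have hb : ‖∫ s in (0:ℝ)..t, curv v s‖ ≤ (K + B) * |t - 0| := by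
      refine intervalIntegral.norm_integral_le_of_norm_le_const fun s hs' => ?_
      rw [Set.uIoc_of_le ht.1] at hs'
      have := abs_curv_sub_le' hs hψ hv hi zero_le_one hK hB 0 s
      have h0 : curv v 0 = 0 := by simp [curv]
      rw [h0, sub_zero, sub_zero, abs_of_pos hs'.1] at this
      rw [Real.norm_eq_abs]
      nlinarith [hs'.2, ht.2]
    rw [sub_zero, abs_of_nonneg ht.1, Real.norm_eq_abs] at hb
    have hb1 : |∫ s in (0:ℝ)..t, curv v s| ≤ 1 := by nlinarith [ht.1, ht.2]
    have hc := Real.one_sub_sq_div_two_le_cos (x := ∫ s in (0:ℝ)..t, curv v s)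
    have hsq : (∫ s in (0:ℝ)..t, curv v s) ^ 2 ≤ 1 := (sq_le_one_iff_abs_le_one _).2 hb1
    unfold heading
    rw [add_comm, Real.sin_add_pi_div_two]
    linarith
  have hlow : ∫ _ in (0:ℝ)..T, (1 / 2 : ℝ) ≤ y₁ := hy ▸
    intervalIntegral.integral_mono_on hT.le (by simp) (hhc.intervalIntegrable _ _) hsin
  have hup : y₁ ≤ ∫ _ in (0:ℝ)..T, (1 : ℝ) := hy ▸
    intervalIntegral.integral_mono_on hT.le (hhc.intervalIntegrable _ _) (by simp)
      fun t _ => sin_le_one _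
  simp only [intervalIntegral.integral_const, smul_eq_mul, sub_zero, mul_one] at hlow hup
  have hy1 : 0 < y₁ := by linarith
  have := hlt.trans_le (min_le_right _ _)
  rw [if_pos hy1] at this
  linarith

theorem tendsto_integral_of_bounded {f : ℕ → ℝ → ℝ} {F : ℝ → ℝ} {t : ℕ → ℝ} {τ M : ℝ}
    (hf : ∀ n, Continuous (f n)) (hM : ∀ n s, |f n s| ≤ M)
    (hF : ∀ s, Tendsto (fun n => f n s) atTop (𝓝 (F s))) (ht : Tendsto t atTop (𝓝 τ)) :
    Tendsto (fun n => ∫ s in (0:ℝ)..(t n), f n s) atTop (𝓝 (∫ s in (0:ℝ)..τ, F s)) := by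
  have h1 : Tendsto (fun n => ∫ s in (0:ℝ)..τ, f n s) atTop (𝓝 (∫ s in (0:ℝ)..τ, F s)) :=
    intervalIntegral.tendsto_integral_filter_of_dominated_convergence (fun _ => M)
      (Eventually.of_forall fun n => (hf n).aestronglyMeasurable)
      (Eventually.of_forall fun n => Eventually.of_forall fun s _ => hM n s)
      intervalIntegrable_const (Eventually.of_forall fun s _ => hF s)
  have h2 : Tendsto (fun n => ∫ s in τ..(t n), f n s) atTop (𝓝 0) := by
    refine squeeze_zero_norm (a := fun n => M * |t n - τ|) (fun n => ?_) ?_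
    · exact intervalIntegral.norm_integral_le_of_norm_le_const fun s _ => hM n s
    · simpa using ((ht.sub_const τ).abs).const_mul M
  have h3 := h1.add h2
  rw [add_zero] at h3
  refine h3.congr fun n => ?_
  exact intervalIntegral.integral_add_adjacent_intervals ((hf n).intervalIntegrable _ _)
    ((hf n).intervalIntegrable _ _)

theorem Hits.of_tendsto {x₁ y₁ θ₁ M : ℝ} {c : ℕ → ℝ → ℝ} {κ : ℝ → ℝ} {t : ℕ → ℝ} {T : ℝ}
    (hc : ∀ n, Continuous (c n)) (hM : ∀ n s, |c n s| ≤ M) (hκc : Continuous κ)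
    (hu : TendstoUniformly c κ atTop) (ht : Tendsto t atTop (𝓝 T))
    (h : ∀ n, Hits x₁ y₁ θ₁ (t n) (c n)) : Hits x₁ y₁ θ₁ T κ := by
  have hpt : ∀ s, Tendsto (fun n => c n s) atTop (𝓝 (κ s)) := fun s => hu.tendsto_at s
  have hhead : ∀ {r : ℕ → ℝ} {ρ : ℝ}, Tendsto r atTop (𝓝 ρ) →
      Tendsto (fun n => heading (c n) (r n)) atTop (𝓝 (heading κ ρ)) := fun hr =>
    (tendsto_integral_of_bounded hc hM hpt hr).const_add _
  refine ⟨?_, ?_, ?_, ?_⟩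
  · refine tendsto_nhds_unique (hu.tendsto_comp hκc.continuousAt ht) ?_
    simp [(h _).1]
  · refine tendsto_nhds_unique (tendsto_integral_of_bounded (M := 1)
      (fun n => continuous_cos.comp (heading_continuous (hc n))) (fun n s => abs_cos_le_one _)
      (fun s => (continuous_cos.tendsto _).comp (hhead tendsto_const_nhds)) ht) ?_
    simp [(h _).2.1]
  · refine tendsto_nhds_unique (tendsto_integral_of_bounded (M := 1)
      (fun n => continuous_sin.comp (heading_continuous (hc n))) (fun n s => abs_sin_le_one _)
      (fun s => (continuous_sin.tendsto _).comp (hhead tendsto_const_nhds)) ht) ?_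
    simp [(h _).2.2.1]
  · refine tendsto_nhds_unique ((Real.Angle.continuous_coe.tendsto _).comp (hhead ht)) ?_
    simp [Function.comp_def, (h _).2.2.2]

theorem energy_bounds {φ ψ : ℝ → ℝ} {x₁ y₁ θ₁ T : ℝ} {v : ℝ → ℝ} (hφ : ∀ r, 0 ≤ φ r)
    (hψ : ∀ r, 0 ≤ ψ r) (h : Competitor ψ x₁ y₁ θ₁ v T) :
    0 < T ∧ T ≤ energy φ ψ v T ∧ ∫ t, ψ (v t) ≤ energy φ ψ v T := by
  have hT := h.1
  have h1 : 0 ≤ ∫ t in (0:ℝ)..T, φ (curv v t) :=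
    intervalIntegral.integral_nonneg hT.le fun t _ => hφ _
  have h2 : 0 ≤ ∫ t, ψ (v t) := integral_nonneg fun t => hψ _
  unfold energy
  exact ⟨hT, by linarith, by linarith⟩

theorem exists_minimizer {φ ψ : ℝ → ℝ} (hφ : ∀ r, 0 ≤ φ r) (hφc : Continuous φ)
    (hψ : ∀ r, 0 ≤ ψ r) (hψc : Continuous ψ) (hc : ConvexOn ℝ Set.univ ψ) (hs : Superlinear ψ)
    {x₁ y₁ θ₁ : ℝ} (hne : ∃ v T, Competitor ψ x₁ y₁ θ₁ v T) :
    ∃ (κ : ℝ → ℝ) (T : ℝ), 0 < T ∧ Hits x₁ y₁ θ₁ T κ ∧ κ 0 = 0 ∧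
      AbsolutelyContinuousOnInterval κ 0 T ∧
      IntegrableOn (fun t => ψ (deriv κ t)) (Set.Icc 0 T) ∧
      ∀ v T', Competitor ψ x₁ y₁ θ₁ v T' → cost φ ψ κ (deriv κ) T ≤ energy φ ψ v T' := by
  set E : Set ℝ := {e | ∃ v T, Competitor ψ x₁ y₁ θ₁ v T ∧ energy φ ψ v T = e} with hE
  have hEne : E.Nonempty := let ⟨v, T, h⟩ := hne; ⟨_, v, T, h, rfl⟩
  have hEbdd : BddBelow E := by
    refine ⟨0, ?_⟩
    rintro _ ⟨v, T, h, rfl⟩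
    have := energy_bounds (φ := φ) hφ hψ h
    linarith
  obtain ⟨e, -, he, heE⟩ := exists_seq_tendsto_sInf hEne hEbdd
  obtain ⟨B, hB⟩ := he.bddAbove_range
  choose v₀ T₀ hv₀ hen₀ using heE
  have heB : ∀ n, energy φ ψ (v₀ n) (T₀ n) ≤ B := fun n => by
    rw [hen₀ n]; exact hB (Set.mem_range_self n)
  have hbd : ∀ n, 0 < T₀ n ∧ T₀ n ≤ B ∧ ∫ t, ψ (v₀ n t) ≤ B := fun n => by
    have := energy_bounds (φ := φ) hφ hψ (hv₀ n)
    have := heB n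
    exact ⟨by linarith, by linarith, by linarith⟩
  have hB0 : 0 ≤ B := (hbd 0).1.le.trans (hbd 0).2.1
  obtain ⟨δ, hδ, hδT⟩ := exists_pos_le_time hs hψ hB0 x₁ y₁ θ₁
  obtain ⟨T, hTmem, g₁, hg₁, hT⟩ := (isCompact_Icc (a := δ) (b := B)).tendsto_subseq
    (x := T₀) fun n => ⟨hδT _ _ (hv₀ n) (hbd n).2.2, (hbd n).2.1⟩
  have hsupp₀ : ∀ n t, t ∉ Set.Icc 0 B → v₀ n t = 0 := fun n t ht =>
    (hv₀ n).2.2.1 t fun h => ht ⟨h.1, h.2.trans (hbd n).2.1⟩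
  obtain ⟨κ, g₂, hg₂, hκc, hκu⟩ := exists_subseq_curv hs hψ hB0 (v := fun n => v₀ (g₁ n))
    (fun n => (hv₀ _).2.1) (fun n => hsupp₀ _) (fun n => (hv₀ _).2.2.2.1) (fun n => (hbd _).2.2)
  set v : ℕ → ℝ → ℝ := fun n => v₀ (g₁ (g₂ n)) with hvdef
  set τ : ℕ → ℝ := fun n => T₀ (g₁ (g₂ n)) with hτdef
  have hτ : Tendsto τ atTop (𝓝 T) := hT.comp hg₂.tendsto_atTop
  have hvc : ∀ n, Competitor ψ x₁ y₁ θ₁ (v n) (τ n) := fun n => hv₀ _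
  have hvm : ∀ n, Measurable (v n) := fun n => (hvc n).2.1
  have hvi : ∀ n, Integrable fun t => ψ (v n t) := fun n => (hvc n).2.2.2.1
  have hvB : ∀ n, ∫ t, ψ (v n t) ≤ B := fun n => (hbd _).2.2
  have hcc : ∀ n, Continuous (curv (v n)) := fun n => curv_continuous hs (hvm n) (hvi n)
  have hpt : ∀ t, Tendsto (fun n => curv (v n) t) atTop (𝓝 (κ t)) := fun t => hκu.tendsto_at t
  have hen : Tendsto (fun n => energy φ ψ (v n) (τ n)) atTop (𝓝 (sInf E)) := by
    simp only [hvdef, hτdef, hen₀]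
    exact he.comp (hg₁.comp hg₂).tendsto_atTop
  have hTpos : 0 < T := hδ.trans_le hTmem.1
  obtain ⟨K, hK0, hK⟩ := hs 1 one_pos
  have hM : ∀ n t, |curv (v n) t| ≤ K * B + 1 * B := fun n t => by
    rw [← curv_projIcc hB0 (hsupp₀ _) t]
    have := abs_curv_sub_le' hs hψ (hvm n) (hvi n) zero_le_one hK (hvB n) 0 (Set.projIcc 0 B hB0 t)
    have h0 : curv (v n) 0 = 0 := by simp [curv]
    rw [h0, sub_zero, sub_zero, abs_of_nonneg (Set.projIcc 0 B hB0 t).2.1] at this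
    refine this.trans ?_
    gcongr
    exact (Set.projIcc 0 B hB0 t).2.2
  obtain ⟨M', hM'⟩ := (isCompact_Icc (a := -(K * B + 1 * B))
    (b := K * B + 1 * B)).exists_bound_of_continuousOn hφc.continuousOn
  have hφlim : Tendsto (fun n => ∫ t in (0:ℝ)..(τ n), φ (curv (v n) t)) atTop
      (𝓝 (∫ t in (0:ℝ)..T, φ (κ t))) :=
    tendsto_integral_of_bounded (fun n => hφc.comp (hcc n))
      (fun n t => hM' _ (abs_le.1 (hM n t))) (fun t => (hφc.tendsto _).comp (hpt t)) hτ
  set b := sInf E - T - ∫ t in (0:ℝ)..T, φ (κ t) with hb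
  have hblim : Tendsto (fun n => ∫ t, ψ (v n t)) atTop (𝓝 b) := by
    refine ((hen.sub hτ).sub hφlim).congr fun n => ?_
    unfold energy
    ring
  have hb0 : 0 ≤ b := ge_of_tendsto' hblim fun n => integral_nonneg fun t => hψ _
  have hac : AbsolutelyContinuousOnInterval κ 0 T :=
    absolutelyContinuous_of_tendsto hs hψ hvm hvi hvB hpt 0 T
  have hlsc := lintegral_deriv_le_of_tendsto hs hψ hc hψc hvm hvi hTpos.le hblim hκc hpt
    hac.ae_differentiableAt
  have hmeas : Measurable fun t => ψ (deriv κ t) := hψc.measurable.comp (measurable_deriv κ)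
  have hint : IntegrableOn (fun t => ψ (deriv κ t)) (Set.Ioc 0 T) := by
    refine ⟨hmeas.aestronglyMeasurable, ?_⟩
    rw [hasFiniteIntegral_iff_ofReal (Eventually.of_forall fun t => hψ _)]
    exact hlsc.trans_lt ENNReal.ofReal_lt_top
  have hψb : ∫ t in (0:ℝ)..T, ψ (deriv κ t) ≤ b := by
    rw [intervalIntegral.integral_of_le hTpos.le]
    rw [← ofReal_integral_eq_lintegral_ofReal hint (Eventually.of_forall fun t => hψ _)] at hlsc
    exact (ENNReal.ofReal_le_ofReal_iff hb0).1 hlsc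
  refine ⟨κ, T, hTpos, Hits.of_tendsto hcc hM hκc hκu hτ fun n => (hvc n).2.2.2.2, ?_, hac,
    (integrableOn_Icc_iff_integrableOn_Ioc (by simp)).2 hint, fun v' T' hv' => ?_⟩
  · exact tendsto_nhds_unique (hpt 0) (by simp [curv])
  · have hφi : IntervalIntegrable (fun t => φ (κ t)) volume 0 T :=
      (hφc.comp hκc).intervalIntegrable _ _
    have hcost : cost φ ψ κ (deriv κ) T =
        T + (∫ t in (0:ℝ)..T, φ (κ t)) + ∫ t in (0:ℝ)..T, ψ (deriv κ t) := by
      unfold cost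
      rw [intervalIntegral.integral_add (intervalIntegrable_const.add hφi)
        ((intervalIntegrable_iff_integrableOn_Ioc_of_le hTpos.le).2 hint),
        intervalIntegral.integral_add intervalIntegrable_const hφi]
      simp
    have hinf : sInf E ≤ energy φ ψ v' T' := csInf_le hEbdd ⟨v', T', hv', rfl⟩
    linarith

/-- existence of a cost-minimizing admissible trajectory
steering `X₀ = (0,0,π/2,0)` to any target `X₁ = (x₁,y₁,θ₁,0)`. -/
theorem existence_of_optimal_trajectory
    (φ ψ : ℝ → ℝ) (p C₀ R₀ : ℝ)
    (h1 : H1 φ ψ) (h2 : H2 ψ) (h3 : H3 ψ p C₀ R₀)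
    (x₁ y₁ θ₁ : ℝ) :
    ∃ (x y θ κ u : ℝ → ℝ) (T : ℝ),
      IsOptimal φ ψ p x y θ κ u T Xinit (x₁, y₁, θ₁, 0) := by
  obtain ⟨hφ, hψ, hφ2, hψ2, -, -, -, -, -, hψ0⟩ := h1
  have hs := h3.superlinear hψ
  by_cases hall : ∀ (x y θ κ u : ℝ → ℝ) (T : ℝ), Connects p x y θ κ u T Xinit (x₁, y₁, θ₁, 0) →
      IntervalIntegrable (fun t => 1 + φ (κ t) + ψ (u t)) volume 0 T
  · have hcomp : ∀ (x y θ κ u : ℝ → ℝ) (T : ℝ), Connects p x y θ κ u T Xinit (x₁, y₁, θ₁, 0) →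
        ∃ v, Competitor ψ x₁ y₁ θ₁ v T ∧ energy φ ψ v T = cost φ ψ κ u T :=
      fun x y θ κ u T h => h.competitor hφ hφ2.continuous hψ hψ2.continuous hψ0 hs
        (hall x y θ κ u T h)
    obtain ⟨x, y, θ, κ, u, T, h⟩ := exists_connects (p := p) (by linarith [h3.1]) x₁ y₁ θ₁
    obtain ⟨v, hv, -⟩ := hcomp x y θ κ u T h
    obtain ⟨κ, T, hT, hhits, hκ0, hac, hi, hmin⟩ := exists_minimizer hφ hφ2.continuous hψ
      hψ2.continuous h2.1.convexOn hs ⟨v, T, hv⟩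
    obtain ⟨x, y, hxy⟩ := hhits.connects hψ h3 hT hκ0 hac hi
    refine ⟨x, y, heading κ, κ, deriv κ, T, hxy, fun x' y' θ' κ' u' T' h' => ?_⟩
    obtain ⟨v', hv', he⟩ := hcomp x' y' θ' κ' u' T' h'
    exact he ▸ hmin v' T' hv'
  · -- an admissible trajectory with non-integrable running cost has `cost` zero by convention
    push Not at hall
    obtain ⟨x, y, θ, κ, u, T, h, hni⟩ := hall
    refine ⟨x, y, θ, κ, u, T, h, fun x' y' θ' κ' u' T' h' => ?_⟩
    rw [cost, intervalIntegral.integral_undef hni]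
    exact intervalIntegral.integral_nonneg h'.1.le fun t _ => by
      linarith [hφ (κ' t), hψ (u' t)]

end
end

section
/- For every C>0 there exist δ>0 and R>0 such that the following holds. Let W₀=(x̄₀,ȳ₀,θ₀,κ₀) and W₁=(x̄₁,ȳ₁,θ₁,κ₁) be points with (x̄₁−x̄₀, ȳ₁−ȳ₀) = Γ(cos θ̄, sin θ̄) for some Γ ≥ R and θ̄ ∈ [0,2π]. If |θᵢ−θ̄| < δ and |κᵢ| < δ for i=0,1 (angle differences taken modulo 2π with values in [−π,π]), then any optimal trajectory connecting W₀ to W₁ satisfies C(u,T) ≤ |(x̄₁−x̄₀, ȳ₁−ȳ₀)| + C. -/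
open MeasureTheory Real Set

noncomputable section

/-- The truncated ramp `max (1 - t) 0`, from which the transition profiles are built. -/
def ramp (t : ℝ) : ℝ := max (1 - t) 0

lemma continuous_ramp : Continuous ramp := by unfold ramp; fun_prop

lemma ramp_eq_zero {t : ℝ} (ht : 1 ≤ t) : ramp t = 0 := max_eq_right (by linarith)

lemma ramp_zero : ramp 0 = 1 := by simp [ramp]

lemma ramp_nonneg (t : ℝ) : 0 ≤ ramp t := le_max_right _ _

lemma ramp_le_one {t : ℝ} (ht : 0 ≤ t) : ramp t ≤ 1 := max_le (by linarith) zero_le_one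

lemma hasDerivAt_ramp_pow (n : ℕ) (t : ℝ) :
    HasDerivAt (fun s => ramp s ^ (n + 2)) (-(n + 2) * ramp t ^ (n + 1)) t := by
  rcases lt_trichotomy t 1 with ht | rfl | ht
  · have h : HasDerivAt (fun s : ℝ => (1 - s) ^ (n + 2)) (-(n + 2) * ramp t ^ (n + 1)) t := by
      have := ((hasDerivAt_id t).const_sub 1).pow (n + 2)
      refine this.congr_deriv ?_
      rw [ramp, max_eq_left (by linarith)]
      simp
      ring
    refine h.congr_of_eventuallyEq ?_
    filter_upwards [Iio_mem_nhds ht] with s hs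
    rw [ramp, max_eq_left (by linarith [mem_Iio.1 hs])]
  · rw [ramp_eq_zero le_rfl, zero_pow (by omega), mul_zero, hasDerivAt_iff_isLittleO]
    have hO : (fun s : ℝ => ramp s ^ (n + 2)) =O[nhds 1] fun s => ‖s - 1‖ ^ (n + 2) := by
      refine Asymptotics.IsBigO.of_bound 1 (Filter.Eventually.of_forall fun s => ?_)
      rw [norm_pow, norm_pow, one_mul, norm_norm, Real.norm_of_nonneg (ramp_nonneg s)]
      refine pow_le_pow_left₀ (ramp_nonneg s) (max_le ?_ (norm_nonneg _)) _
      rw [Real.norm_eq_abs, abs_sub_comm]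
      exact le_abs_self _
    have ho := Asymptotics.isLittleO_pow_sub_sub (1 : ℝ) (show 1 < n + 2 by omega)
    simpa [ramp_eq_zero le_rfl] using hO.trans_isLittleO ho
  · rw [ramp_eq_zero ht.le, zero_pow (by omega), mul_zero]
    refine (hasDerivAt_const t (0 : ℝ)).congr_of_eventuallyEq ?_
    filter_upwards [Ioi_mem_nhds ht] with s hs
    simp [ramp_eq_zero (le_of_lt (mem_Ioi.1 hs))]

/-- A `C²` profile with value `a` and slope `k` at `0`, vanishing on `[1, ∞)`. -/
def profile (a k t : ℝ) : ℝ :=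
  a * (4 * ramp t ^ 3 - 3 * ramp t ^ 4) + k * (ramp t ^ 3 - ramp t ^ 4)

/-- The first derivative of `profile a k`. -/
def profileDeriv (a k t : ℝ) : ℝ :=
  a * (12 * ramp t ^ 3 - 12 * ramp t ^ 2) + k * (4 * ramp t ^ 3 - 3 * ramp t ^ 2)

/-- The second derivative of `profile a k`. -/
def profileDeriv₂ (a k t : ℝ) : ℝ :=
  a * (24 * ramp t - 36 * ramp t ^ 2) + k * (6 * ramp t - 12 * ramp t ^ 2)

lemma hasDerivAt_profile (a k t : ℝ) : HasDerivAt (profile a k) (profileDeriv a k t) t := by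
  have h3 := hasDerivAt_ramp_pow 1 t
  have h4 := hasDerivAt_ramp_pow 2 t
  refine ((((h3.const_mul 4).sub (h4.const_mul 3)).const_mul a).add
    ((h3.sub h4).const_mul k)).congr_deriv ?_
  simp only [profileDeriv]
  push_cast
  ring

lemma hasDerivAt_profileDeriv (a k t : ℝ) :
    HasDerivAt (profileDeriv a k) (profileDeriv₂ a k t) t := by
  have h2 := hasDerivAt_ramp_pow 0 t
  have h3 := hasDerivAt_ramp_pow 1 t
  refine ((((h3.const_mul 12).sub (h2.const_mul 12)).const_mul a).add
    (((h3.const_mul 4).sub (h2.const_mul 3)).const_mul k)).congr_deriv ?_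
  simp only [profileDeriv₂]
  push_cast
  ring

@[fun_prop]
lemma continuous_profile : Continuous fun q : ℝ × ℝ × ℝ => profile q.1 q.2.1 q.2.2 := by
  have := continuous_ramp
  unfold profile
  fun_prop

@[fun_prop]
lemma continuous_profileDeriv (a k : ℝ) : Continuous (profileDeriv a k) := by
  have := continuous_ramp
  unfold profileDeriv
  fun_prop

@[fun_prop]
lemma continuous_profileDeriv₂ (a k : ℝ) : Continuous (profileDeriv₂ a k) := by
  have := continuous_ramp
  unfold profileDeriv₂
  fun_prop

lemma profile_eq_zero (a k : ℝ) {t : ℝ} (ht : 1 ≤ t) : profile a k t = 0 := by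
  simp [profile, ramp_eq_zero ht]

lemma profileDeriv_eq_zero (a k : ℝ) {t : ℝ} (ht : 1 ≤ t) : profileDeriv a k t = 0 := by
  simp [profileDeriv, ramp_eq_zero ht]

lemma profileDeriv₂_eq_zero (a k : ℝ) {t : ℝ} (ht : 1 ≤ t) : profileDeriv₂ a k t = 0 := by
  simp [profileDeriv₂, ramp_eq_zero ht]

lemma profile_zero (a k : ℝ) : profile a k 0 = a := by simp [profile, ramp_zero]; ring

lemma profileDeriv_zero (a k : ℝ) : profileDeriv a k 0 = k := by
  simp [profileDeriv, ramp_zero]; ring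

lemma abs_linear_comb_le {a k v w e : ℝ} (ha : |a| ≤ e) (hk : |k| ≤ e) (hv : |v| ≤ 60)
    (hw : |w| ≤ 40) : |a * v + k * w| ≤ 100 * e := by
  have he : 0 ≤ e := (abs_nonneg a).trans ha
  calc |a * v + k * w| ≤ |a| * |v| + |k| * |w| := by
        rw [← abs_mul, ← abs_mul]; exact abs_add_le _ _
    _ ≤ e * 60 + e * 40 := by gcongr
    _ = 100 * e := by ring

lemma abs_profile_le {a k e t : ℝ} (ha : |a| ≤ e) (hk : |k| ≤ e) (ht : 0 ≤ t) :
    |profile a k t| ≤ 100 * e ∧ |profileDeriv a k t| ≤ 100 * e ∧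
      |profileDeriv₂ a k t| ≤ 100 * e := by
  have h0 := ramp_nonneg t
  have h1 := ramp_le_one ht
  have b2 := pow_le_one₀ (n := 2) h0 h1
  have b3 := pow_le_one₀ (n := 3) h0 h1
  have b4 := pow_le_one₀ (n := 4) h0 h1
  have c2 := pow_nonneg h0 2
  have c3 := pow_nonneg h0 3
  have c4 := pow_nonneg h0 4
  refine ⟨abs_linear_comb_le ha hk ?_ ?_, abs_linear_comb_le ha hk ?_ ?_,
    abs_linear_comb_le ha hk ?_ ?_⟩ <;> rw [abs_le] <;> constructor <;> linarith

lemma integral_eq_of_vanish {f : ℝ → ℝ} (hf : Continuous f) (h0 : ∀ t, 1 ≤ t → f t = 0)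
    {T : ℝ} (hT : 1 ≤ T) : ∫ t in (0:ℝ)..T, f t = ∫ t in (0:ℝ)..1, f t := by
  rw [← intervalIntegral.integral_add_adjacent_intervals (hf.intervalIntegrable 0 1)
    (hf.intervalIntegrable 1 T), add_eq_left]
  refine intervalIntegral.integral_zero_ae (Filter.Eventually.of_forall fun t ht => ?_)
  rw [uIoc_of_le hT] at ht
  exact h0 t ht.1.le

/-- The integral of two end contributions, one read backwards from the final time. -/
lemma integral_two_ends {f g : ℝ → ℝ} (hf : Continuous f) (hg : Continuous g)
    (hf0 : ∀ t, 1 ≤ t → f t = 0) (hg0 : ∀ t, 1 ≤ t → g t = 0) {T : ℝ} (hT : 1 ≤ T) :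
    ∫ t in (0:ℝ)..T, (f t + g (T - t)) = (∫ t in (0:ℝ)..1, f t) + ∫ t in (0:ℝ)..1, g t := by
  rw [intervalIntegral.integral_add (hf.intervalIntegrable _ _)
    ((by fun_prop : Continuous fun t => g (T - t)).intervalIntegrable _ _),
    intervalIntegral.integral_comp_sub_left, sub_self, sub_zero,
    integral_eq_of_vanish hf hf0 hT, integral_eq_of_vanish hg hg0 hT]

/-- A function of the sum of two end contributions splits when the two ends do not overlap. -/
lemma integral_comp_two_ends {F : ℝ → ℝ} (hF : Continuous F) (hF0 : F 0 = 0) {f g : ℝ → ℝ}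
    (hf : Continuous f) (hg : Continuous g) (hf0 : ∀ t, 1 ≤ t → f t = 0)
    (hg0 : ∀ t, 1 ≤ t → g t = 0) {T : ℝ} (hT : 2 ≤ T) :
    ∫ t in (0:ℝ)..T, F (f t + g (T - t)) =
      (∫ t in (0:ℝ)..1, F (f t)) + ∫ t in (0:ℝ)..1, F (g t) := by
  rw [← integral_two_ends (f := fun t => F (f t)) (g := fun t => F (g t)) (by fun_prop)
    (by fun_prop) (fun t ht => by simp [hf0 t ht, hF0]) (fun t ht => by simp [hg0 t ht, hF0])
    (by linarith)]
  congr 1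
  funext t
  rcases le_total 1 t with ht | ht
  · simp [hf0 t ht, hF0]
  · simp [hg0 (T - t) (by linarith), hF0]

lemma integral_zero_one_le {f : ℝ → ℝ} (hf : Continuous f) {M : ℝ}
    (h : ∀ t, 0 ≤ t → f t ≤ M) : ∫ t in (0:ℝ)..1, f t ≤ M := by
  have := intervalIntegral.integral_mono_on zero_le_one (hf.intervalIntegrable 0 1)
    (intervalIntegrable_const (μ := volume) (c := M)) fun t ht => h t ht.1
  simpa using this

lemma exists_abs_sub_lt_of_angleDist_lt {a b d : ℝ} (h : angleDist a b < d) :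
    ∃ k : ℤ, |a - b - 2 * π * k| < d := by
  have h' : ‖((a - b : ℝ) : AddCircle (2 * π))‖ < d := h
  rw [AddCircle.norm_eq] at h'
  exact ⟨round ((2 * π)⁻¹ * (a - b)), by rwa [mul_comm (2 * π)]⟩

/-- The middle angle can be tuned so that the two ends produce no lateral displacement. -/
lemma exists_middle_angle {a b k l e G : ℝ} (he : 0 ≤ e) (hG : 2 ≤ G * sin e) :
    ∃ c ∈ Icc (-e) e, (∫ t in (0:ℝ)..1, sin (profile (a - c) k t)) +
      (∫ t in (0:ℝ)..1, sin (profile (b - c) l t)) + G * sin c = 0 := by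
  have hcont : ∀ a k : ℝ, Continuous fun c => ∫ t in (0:ℝ)..1, sin (profile (a - c) k t) :=
    fun a k => intervalIntegral.continuous_parametric_intervalIntegral_of_continuous'
      (by
        show Continuous fun q : ℝ × ℝ => sin (profile (a - q.1) k q.2)
        exact continuous_sin.comp (continuous_profile.comp
          (by fun_prop : Continuous fun q : ℝ × ℝ => (a - q.1, k, q.2)))) 0 1
  have hbd : ∀ a k c : ℝ, |∫ t in (0:ℝ)..1, sin (profile (a - c) k t)| ≤ 1 := fun a k c => by
    have := intervalIntegral.norm_integral_le_of_norm_le_const (a := 0) (b := 1) (C := 1)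
      (f := fun t => sin (profile (a - c) k t)) fun t _ => abs_sin_le_one _
    simpa using this
  have hivt := intermediate_value_Icc (a := -e) (b := e)
    (f := fun c => (∫ t in (0:ℝ)..1, sin (profile (a - c) k t)) +
      (∫ t in (0:ℝ)..1, sin (profile (b - c) l t)) + G * sin c) (by linarith)
    (((hcont a k).add (hcont b l)).add (by fun_prop)).continuousOn
  refine hivt ⟨?_, ?_⟩
  · have h1 := abs_le.1 (hbd a k (-e))
    have h2 := abs_le.1 (hbd b l (-e))
    simp only [sin_neg]
    linarith
  · have h1 := abs_le.1 (hbd a k e)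
    have h2 := abs_le.1 (hbd b l e)
    linarith

lemma continuous_profile_time (a k : ℝ) : Continuous (profile a k) :=
  continuous_iff_continuousAt.2 fun t => (hasDerivAt_profile a k t).continuousAt

/-- A trajectory made of two short transitions joined by a long straight piece. -/
lemma exists_competitor {φ ψ : ℝ → ℝ} (hφ : Continuous φ) (hψ : Continuous ψ)
    (hφe : ∀ r, φ (-r) = φ r) (hφ0 : φ 0 = 0) (hψ0 : ψ 0 = 0) {p : ℝ} (hp : 0 ≤ p) {e M : ℝ}
    (he : 0 ≤ e) (hsmall : ∀ r, |r| ≤ 200 * e → φ r ≤ M ∧ ψ r ≤ M ∧ 1 - cos r ≤ M)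
    {G θb a b k l : ℝ} (hGs : 2 ≤ G * sin e) (hGc : 2 ≤ G * cos e) (heπ : e ≤ π) (hG : 0 ≤ G)
    (ha : |a| ≤ e) (hb : |b| ≤ e) (hk : |k| ≤ e) (hl : |l| ≤ e) {W₀ W₁ : ℝ × ℝ × ℝ × ℝ} {m n : ℤ}
    (hx : W₁.1 - W₀.1 = G * cos θb) (hy : W₁.2.1 - W₀.2.1 = G * sin θb)
    (hθ₀ : W₀.2.2.1 = θb + a + 2 * π * m) (hθ₁ : W₁.2.2.1 = θb + b + 2 * π * n)
    (hκ₀ : W₀.2.2.2 = k) (hκ₁ : W₁.2.2.2 = l) :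
    ∃ (x y θ κ u : ℝ → ℝ) (T : ℝ), Connects p x y θ κ u T W₀ W₁ ∧
      cost φ ψ κ u T ≤ G + 6 * M := by
  obtain ⟨c, ⟨hc₁, hc₂⟩, hc⟩ := exists_middle_angle (a := a) (b := b) (k := k) (l := -l) he hGs
  have hcabs : |c| ≤ e := abs_le.2 ⟨hc₁, hc₂⟩
  have hac : |a - c| ≤ 2 * e := (abs_sub _ _).trans (by linarith)
  have hbc : |b - c| ≤ 2 * e := (abs_sub _ _).trans (by linarith)
  have hk2 : |k| ≤ 2 * e := by linarith
  have hl2 : |-l| ≤ 2 * e := by rw [abs_neg]; linarith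
  have hp₀ := fun t (ht : (0:ℝ) ≤ t) => abs_profile_le hac hk2 ht
  have hp₁ := fun t (ht : (0:ℝ) ≤ t) => abs_profile_le hbc hl2 ht
  have cf := continuous_profile_time (a - c) k
  have cg := continuous_profile_time (b - c) (-l)
  set f := profile (a - c) k with hf
  set g := profile (b - c) (-l) with hg
  set f' := profileDeriv (a - c) k with hf'
  set g' := profileDeriv (b - c) (-l) with hg'
  set f'' := profileDeriv₂ (a - c) k with hf''
  set g'' := profileDeriv₂ (b - c) (-l) with hg''
  have cf' : Continuous f' := continuous_profileDeriv _ _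
  have cg' : Continuous g' := continuous_profileDeriv _ _
  have cf'' : Continuous f'' := continuous_profileDeriv₂ _ _
  have cg'' : Continuous g'' := continuous_profileDeriv₂ _ _
  have zf : ∀ t, 1 ≤ t → f t = 0 := fun t => profile_eq_zero _ _
  have zg : ∀ t, 1 ≤ t → g t = 0 := fun t => profile_eq_zero _ _
  have zf' : ∀ t, 1 ≤ t → f' t = 0 := fun t => profileDeriv_eq_zero _ _
  have zg' : ∀ t, 1 ≤ t → g' t = 0 := fun t => profileDeriv_eq_zero _ _
  have zf'' : ∀ t, 1 ≤ t → f'' t = 0 := fun t => profileDeriv₂_eq_zero _ _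
  have zg'' : ∀ t, 1 ≤ t → g'' t = 0 := fun t => profileDeriv₂_eq_zero _ _
  have e200 : 100 * (2 * e) = 200 * e := by ring
  rw [e200] at hp₀ hp₁
  set A := (∫ t in (0:ℝ)..1, (1 - cos (f t))) + ∫ t in (0:ℝ)..1, (1 - cos (g t)) with hA
  have hA0 : 0 ≤ A := add_nonneg
    (intervalIntegral.integral_nonneg zero_le_one fun t _ => by linarith [cos_le_one (f t)])
    (intervalIntegral.integral_nonneg zero_le_one fun t _ => by linarith [cos_le_one (g t)])
  have hAM : A ≤ 2 * M := by
    have h₁ := integral_zero_one_le (f := fun t => 1 - cos (f t)) (by fun_prop)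
      fun t ht => (hsmall _ (hp₀ t ht).1).2.2
    have h₂ := integral_zero_one_le (f := fun t => 1 - cos (g t)) (by fun_prop)
      fun t ht => (hsmall _ (hp₁ t ht).1).2.2
    linarith
  set T := G * cos c + A with hTdef
  have hcc : cos e ≤ cos c := by
    rw [← cos_abs c]
    exact cos_le_cos_of_nonneg_of_le_pi (abs_nonneg c) heπ hcabs
  have hT : 2 ≤ T := by
    have := mul_le_mul_of_nonneg_left hcc hG
    linarith
  have hTG : T ≤ G + 2 * M := by
    have := mul_le_mul_of_nonneg_left (cos_le_one c) hG
    linarith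
  set θ : ℝ → ℝ := fun t => θb + 2 * π * m + c + (f t + g (T - t)) with hθ
  set κ : ℝ → ℝ := fun t => f' t + -g' (T - t) with hκ
  set u : ℝ → ℝ := fun t => f'' t + g'' (T - t) with hu
  have cθ : Continuous θ := by fun_prop
  have cκ : Continuous κ := by fun_prop
  have cu : Continuous u := by fun_prop
  have dθ : ∀ t, HasDerivAt θ (κ t) t := fun t => by
    have h₁ := hasDerivAt_profile (a - c) k t
    have h₂ := (hasDerivAt_profile (b - c) (-l) (T - t)).comp_const_sub T t
    exact (h₁.add h₂).const_add _
  have dκ : ∀ t, HasDerivAt κ (u t) t := fun t => by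
    have h₁ := hasDerivAt_profileDeriv (a - c) k t
    have h₂ := (hasDerivAt_profileDeriv (b - c) (-l) (T - t)).comp_const_sub T t
    exact (h₁.add h₂.neg).congr_deriv (by simp [hu, hf'', hg''])
  have hcosI : ∫ t in (0:ℝ)..T, cos (f t + g (T - t)) = G * cos c := by
    have h := integral_comp_two_ends (F := fun r => 1 - cos r) (by fun_prop) (by simp)
      cf cg zf zg hT
    rw [intervalIntegral.integral_sub (by simp)
      ((by fun_prop : Continuous fun t => cos (f t + g (T - t))).intervalIntegrable _ _)] at h
    simp only [intervalIntegral.integral_const, smul_eq_mul, mul_one, sub_zero] at h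
    linarith
  have hsinI : ∫ t in (0:ℝ)..T, sin (f t + g (T - t)) = -(G * sin c) := by
    have h := integral_comp_two_ends (F := sin) (by fun_prop) (by simp) cf cg zf zg hT
    linarith
  have icos := (by fun_prop : Continuous fun t => cos (f t + g (T - t))).intervalIntegrable
    (μ := volume) 0 T
  have isin := (by fun_prop : Continuous fun t => sin (f t + g (T - t))).intervalIntegrable
    (μ := volume) 0 T
  have hang : ∀ t, θ t = (θb + c + (f t + g (T - t))) + m * (2 * π) := fun t => by
    simp only [hθ]; ring
  have hX : ∫ t in (0:ℝ)..T, cos (θ t) = G * cos θb := by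
    have : ∀ t, cos (θ t) = cos (θb + c) * cos (f t + g (T - t)) -
        sin (θb + c) * sin (f t + g (T - t)) := fun t => by
      rw [hang, cos_add_int_mul_two_pi, cos_add]
    simp only [this]
    rw [intervalIntegral.integral_sub (icos.const_mul _) (isin.const_mul _),
      intervalIntegral.integral_const_mul, intervalIntegral.integral_const_mul, hcosI, hsinI,
      show cos θb = cos (θb + c - c) by ring_nf, cos_sub]
    ring
  have hY : ∫ t in (0:ℝ)..T, sin (θ t) = G * sin θb := by
    have : ∀ t, sin (θ t) = sin (θb + c) * cos (f t + g (T - t)) +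
        cos (θb + c) * sin (f t + g (T - t)) := fun t => by
      rw [hang, sin_add_int_mul_two_pi, sin_add]
    simp only [this]
    rw [intervalIntegral.integral_add (icos.const_mul _) (isin.const_mul _),
      intervalIntegral.integral_const_mul, intervalIntegral.integral_const_mul, hcosI, hsinI,
      show sin θb = sin (θb + c - c) by ring_nf, sin_sub]
    ring
  have hT1 : 1 ≤ T := by linarith
  refine ⟨fun t => W₀.1 + ∫ s in (0:ℝ)..t, cos (θ s), fun t => W₀.2.1 + ∫ s in (0:ℝ)..t, sin (θ s),
    θ, κ, u, T, ⟨by linarith, cu.measurable, ?_, by simp, by simp, ?_, ?_, ?_, ?_, ?_, ?_, ?_, ?_,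
      ⟨m - n, ?_⟩, ?_⟩, ?_⟩
  · exact ((cu.abs).rpow_const fun _ => Or.inr hp).continuousOn.integrableOn_Icc
  · simp only [hθ, sub_zero, zg T hT1, hf, profile_zero, hθ₀]; ring
  · simp only [hκ, sub_zero, zg' T hT1, hf', profileDeriv_zero, hκ₀]; ring
  · intro t _; simp
  · intro t _; simp
  · intro t _
    rw [intervalIntegral.integral_eq_sub_of_hasDerivAt (fun s _ => dθ s)
      (cκ.intervalIntegrable _ _)]
    ring
  · intro t _
    rw [intervalIntegral.integral_eq_sub_of_hasDerivAt (fun s _ => dκ s)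
      (cu.intervalIntegrable _ _)]
    ring
  · simp only [hX]; linarith
  · simp only [hY]; linarith
  · simp only [hθ, sub_self, zf T hT1, hg, profile_zero, hθ₁]; push_cast; ring
  · simp only [hκ, sub_self, zf' T hT1, hg', profileDeriv_zero, hκ₁]; ring
  · have hφI := integral_comp_two_ends hφ hφ0 cf' cg'.neg zf' (fun t ht => by simp [zg' t ht]) hT
    have hψI := integral_comp_two_ends hψ hψ0 cf'' cg'' zf'' zg'' hT
    have h₁ := integral_zero_one_le (f := fun t => φ (f' t)) (by fun_prop)
      fun t ht => (hsmall _ (hp₀ t ht).2.1).1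
    have h₂ := integral_zero_one_le (f := fun t => φ (-g' t)) (by fun_prop)
      fun t ht => by rw [hφe]; exact (hsmall _ (hp₁ t ht).2.1).1
    have h₃ := integral_zero_one_le (f := fun t => ψ (f'' t)) (by fun_prop)
      fun t ht => (hsmall _ (hp₀ t ht).2.2).2.1
    have h₄ := integral_zero_one_le (f := fun t => ψ (g'' t)) (by fun_prop)
      fun t ht => (hsmall _ (hp₁ t ht).2.2).2.1
    unfold cost
    rw [intervalIntegral.integral_add
      ((by fun_prop : Continuous fun t => 1 + φ (κ t)).intervalIntegrable _ _)
      ((by fun_prop : Continuous fun t => ψ (u t)).intervalIntegrable _ _),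
      intervalIntegral.integral_add (by simp)
      ((by fun_prop : Continuous fun t => φ (κ t)).intervalIntegrable _ _)]
    simp only [intervalIntegral.integral_const, smul_eq_mul, mul_one, sub_zero, hκ, hu]
    simp only [Pi.neg_apply] at hφI
    linarith

/-- trajectories close to a long segment have cost at most the
segment's length plus `C`. -/
theorem near_segment_cost_estimate
    (φ ψ : ℝ → ℝ) (p C₀ R₀ : ℝ)
    (h1 : H1 φ ψ) (h2 : H2 ψ) (h3 : H3 ψ p C₀ R₀)
    (C : ℝ) (hC : 0 < C) :
    ∃ δ > (0:ℝ), ∃ R > (0:ℝ),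
      ∀ W₀ W₁ : ℝ × ℝ × ℝ × ℝ, ∀ Γ θb : ℝ,
        R ≤ Γ → θb ∈ Set.Icc 0 (2*π) →
        W₁.1 - W₀.1 = Γ * Real.cos θb →
        W₁.2.1 - W₀.2.1 = Γ * Real.sin θb →
        angleDist W₀.2.2.1 θb < δ → angleDist W₁.2.2.1 θb < δ →
        |W₀.2.2.2| < δ → |W₁.2.2.2| < δ →
        ∀ (x y θ κ u : ℝ → ℝ) (T : ℝ),
          IsOptimal φ ψ p x y θ κ u T W₀ W₁ →
          cost φ ψ κ u T ≤
            Real.sqrt ((W₁.1 - W₀.1)^2 + (W₁.2.1 - W₀.2.1)^2) + C := by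
  obtain ⟨-, -, hφc, hψc, hφe, -, -, -, hφ0, hψ0⟩ := h1
  have hφ := hφc.continuous
  have hψ := hψc.continuous
  have hev : ∀ᶠ r in nhds (0:ℝ), φ r < C / 6 ∧ ψ r < C / 6 ∧ 1 - cos r < C / 6 := by
    refine (hφ.tendsto 0).eventually_lt_const ?_ |>.and
      ((hψ.tendsto 0).eventually_lt_const ?_ |>.and
        (((by fun_prop : Continuous fun r : ℝ => 1 - cos r).tendsto 0).eventually_lt_const ?_))
    · rw [hφ0]; positivity
    · rw [hψ0]; positivity
    · simp only [cos_zero, sub_self]; positivity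
  obtain ⟨η, hη, hsmall⟩ := Metric.eventually_nhds_iff.1 hev
  set e := min (η / 201) 1 with he
  have he0 : 0 < e := lt_min (by positivity) one_pos
  have he1 : e ≤ 1 := min_le_right _ _
  have heη : e ≤ η / 201 := min_le_left _ _
  have hsin : 0 < sin e := sin_pos_of_pos_of_lt_pi he0 (by linarith [pi_gt_three])
  have hcos : 0 < cos e := cos_pos_of_mem_Ioo ⟨by linarith [pi_gt_three], by linarith [pi_gt_three]⟩
  refine ⟨e, he0, 2 / sin e + 2 / cos e, by positivity, ?_⟩
  intro W₀ W₁ Γ θb hΓ _ hx hy hθ₀ hθ₁ hκ₀ hκ₁ x y θ κ u T hopt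
  have hs : 0 < 2 / sin e := by positivity
  have hc : 0 < 2 / cos e := by positivity
  have hΓ0 : 0 ≤ Γ := by linarith
  obtain ⟨m, hm⟩ := exists_abs_sub_lt_of_angleDist_lt hθ₀
  obtain ⟨n, hn⟩ := exists_abs_sub_lt_of_angleDist_lt hθ₁
  obtain ⟨x', y', θ', κ', u', T', hcon, hcost⟩ := exists_competitor hφ hψ hφe hφ0 hψ0
    (by linarith [h3.1] : 0 ≤ p) he0.le (M := C / 6) (G := Γ)
    (fun r hr => by
      have := hsmall (y := r) (by rw [dist_zero_right, Real.norm_eq_abs]; linarith)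
      exact ⟨this.1.le, this.2.1.le, this.2.2.le⟩)
    ((div_le_iff₀ hsin).1 (by linarith)) ((div_le_iff₀ hcos).1 (by linarith))
    (by linarith [pi_gt_three]) hΓ0 hm.le hn.le hκ₀.le hκ₁.le hx hy (m := m) (n := n)
    (by ring) (by ring) rfl rfl
  have hsq : (W₁.1 - W₀.1) ^ 2 + (W₁.2.1 - W₀.2.1) ^ 2 = Γ ^ 2 := by
    rw [hx, hy]
    linear_combination Γ ^ 2 * sin_sq_add_cos_sq θb
  rw [hsq, Real.sqrt_sq hΓ0]
  have := hopt.2 _ _ _ _ _ _ hcon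
  linarith

end
end

section
/- There exist positive constants C_{φ,ψ} and T_{φ,ψ} such that for every optimal trajectory on [0,T] with |(x₁,y₁)| ≥ 8√π and T > T_{φ,ψ}, equipped with PMP adjoint data (ρ, φ̂, p₃, p₄), one has ‖(p₃,p₄)‖_{L^∞([0,T])} ≤ C_{φ,ψ}(1+ρ). -/
open MeasureTheory Real Set

noncomputable section

lemma deriv_smoothTransition_eq_zero {t : ℝ} (ht : t ≤ 0 ∨ 1 ≤ t) :
    deriv smoothTransition t = 0 := by
  rcases ht with ht | ht
  · refine IsLocalMin.deriv_eq_zero (Filter.Eventually.of_forall fun s => ?_)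
    rw [smoothTransition.zero_of_nonpos ht]
    exact smoothTransition.nonneg s
  · refine IsLocalMax.deriv_eq_zero (Filter.Eventually.of_forall fun s => ?_)
    rw [smoothTransition.one_of_one_le ht]
    exact smoothTransition.le_one s

lemma deriv_deriv_smoothTransition_eq_zero {t : ℝ} (ht : t < 0 ∨ 1 < t) :
    deriv (deriv smoothTransition) t = 0 := by
  have h : deriv smoothTransition =ᶠ[nhds t] fun _ => 0 := by
    rcases ht with ht | ht
    · filter_upwards [Iio_mem_nhds ht] with s hs
      exact deriv_smoothTransition_eq_zero (Or.inl hs.le)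
    · filter_upwards [Ioi_mem_nhds ht] with s hs
      exact deriv_smoothTransition_eq_zero (Or.inr hs.le)
  rw [h.deriv_eq, deriv_const]

lemma contDiff_deriv_smoothTransition : ContDiff ℝ 1 (deriv smoothTransition) :=
  ((contDiff_succ_iff_deriv (n := 1)).1 (smoothTransition.contDiff (n := 2))).2.2

lemma continuous_deriv_deriv_smoothTransition :
    Continuous (deriv (deriv smoothTransition)) :=
  contDiff_deriv_smoothTransition.continuous_deriv le_rfl

lemma hasDerivAt_smoothTransition (t : ℝ) :
    HasDerivAt smoothTransition (deriv smoothTransition t) t :=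
  ((smoothTransition.contDiff (n := 1)).differentiable one_ne_zero t).hasDerivAt

lemma hasDerivAt_deriv_smoothTransition (t : ℝ) :
    HasDerivAt (deriv smoothTransition) (deriv (deriv smoothTransition) t) t :=
  (contDiff_deriv_smoothTransition.differentiable one_ne_zero t).hasDerivAt

/-- An integral over `[0, 2 + ℓ]` of a function assembled from a first manoeuvre on `[0, 1]`,
a straight part and a last manoeuvre on `[1 + ℓ, 2 + ℓ]`. -/
lemma integral_eq_of_three_pieces {f g h : ℝ → ℝ} (hf : Continuous f) {c ℓ : ℝ} (hℓ : 0 ≤ ℓ)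
    (h₁ : ∀ t ∈ Ioo (0:ℝ) 1, f t = g t) (h₂ : ∀ t ∈ Ioo 1 (1 + ℓ), f t = c)
    (h₃ : ∀ t ∈ Ioo (1 + ℓ) (2 + ℓ), f t = h (t - (1 + ℓ))) :
    ∫ t in (0:ℝ)..(2 + ℓ), f t = (∫ t in (0:ℝ)..1, g t) + ℓ * c + ∫ t in (0:ℝ)..1, h t := by
  have hi : ∀ a b, IntervalIntegrable f volume a b := fun a b => hf.intervalIntegrable a b
  rw [← intervalIntegral.integral_add_adjacent_intervals (hi 0 (1 + ℓ)) (hi (1 + ℓ) _),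
    ← intervalIntegral.integral_add_adjacent_intervals (hi 0 1) (hi 1 _),
    intervalIntegral.integral_congr_Ioo_of_le zero_le_one h₁,
    intervalIntegral.integral_congr_Ioo_of_le (by linarith) h₂,
    intervalIntegral.integral_congr_Ioo_of_le (by linarith) h₃,
    intervalIntegral.integral_comp_sub_right]
  simp only [intervalIntegral.integral_const, smul_eq_mul]
  rw [show 1 + ℓ - (1 + ℓ) = 0 by ring, show 2 + ℓ - (1 + ℓ) = 1 by ring]
  ring

/-- A heading `β` and a length `ℓ` such that turning from `π / 2` to `β`, driving straight for a
length `ℓ` and turning from `β` to `c` leads from the origin to `(x₁, y₁)`. -/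
lemma exists_heading (x₁ y₁ c : ℝ) (hD : 8 ≤ √(x₁ ^ 2 + y₁ ^ 2)) :
    ∃ β ℓ : ℝ, |β| ≤ 2 * π ∧ 0 ≤ ℓ ∧ ℓ ≤ √(x₁ ^ 2 + y₁ ^ 2) + 4 ∧
      (∫ t in (0:ℝ)..1, cos (π / 2 + (β - π / 2) * smoothTransition t)) + ℓ * cos β
        + (∫ t in (0:ℝ)..1, cos (β + (c - β) * smoothTransition t)) = x₁ ∧
      (∫ t in (0:ℝ)..1, sin (π / 2 + (β - π / 2) * smoothTransition t)) + ℓ * sin β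
        + (∫ t in (0:ℝ)..1, sin (β + (c - β) * smoothTransition t)) = y₁ := by
  set D := √(x₁ ^ 2 + y₁ ^ 2) with hDdef
  have hS : Continuous smoothTransition := smoothTransition.continuous
  have hcont : ∀ F : ℝ → ℝ, Continuous F → ∀ a b : ℝ → ℝ, Continuous a → Continuous b →
      Continuous fun β => ∫ t in (0:ℝ)..1, F (a β + b β * smoothTransition t) := by
    intro F hF a b ha hb
    exact intervalIntegral.continuous_parametric_intervalIntegral_of_continuous'
      (f := fun β t => F (a β + b β * smoothTransition t))
      (by unfold Function.uncurry; fun_prop) 0 1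
  have hbd : ∀ F : ℝ → ℝ, (∀ r, |F r| ≤ 1) → |∫ t in (0:ℝ)..1, F t| ≤ 1 := by
    intro F hF
    have := intervalIntegral.norm_integral_le_of_norm_le_const (f := F) (a := 0) (b := 1)
      (C := 1) (fun x _ => hF x)
    simpa using this
  obtain ⟨Vx, hVx⟩ : ∃ V : ℝ → ℝ, V = fun β =>
      (∫ t in (0:ℝ)..1, cos (π / 2 + (β - π / 2) * smoothTransition t))
        + ∫ t in (0:ℝ)..1, cos (β + (c - β) * smoothTransition t) := ⟨_, rfl⟩
  obtain ⟨Vy, hVy⟩ : ∃ V : ℝ → ℝ, V = fun β =>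
      (∫ t in (0:ℝ)..1, sin (π / 2 + (β - π / 2) * smoothTransition t))
        + ∫ t in (0:ℝ)..1, sin (β + (c - β) * smoothTransition t) := ⟨_, rfl⟩
  have hVxc : Continuous Vx := by
    rw [hVx]
    exact (hcont cos continuous_cos (fun _ => π / 2) (fun β => β - π / 2) (by fun_prop)
      (by fun_prop)).add (hcont cos continuous_cos (fun β => β) (fun β => c - β) (by fun_prop)
      (by fun_prop))
  have hVyc : Continuous Vy := by
    rw [hVy]
    exact (hcont sin continuous_sin (fun _ => π / 2) (fun β => β - π / 2) (by fun_prop)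
      (by fun_prop)).add (hcont sin continuous_sin (fun β => β) (fun β => c - β) (by fun_prop)
      (by fun_prop))
  have hVxb : ∀ β, |Vx β| ≤ 2 := by
    intro β
    rw [hVx]
    refine (abs_add_le _ _).trans ?_
    linarith [hbd (fun t => cos (π / 2 + (β - π / 2) * smoothTransition t))
        (fun _ => abs_cos_le_one _),
      hbd (fun t => cos (β + (c - β) * smoothTransition t)) (fun _ => abs_cos_le_one _)]
  have hVyb : ∀ β, |Vy β| ≤ 2 := by
    intro β
    rw [hVy]
    refine (abs_add_le _ _).trans ?_
    linarith [hbd (fun t => sin (π / 2 + (β - π / 2) * smoothTransition t))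
        (fun _ => abs_sin_le_one _),
      hbd (fun t => sin (β + (c - β) * smoothTransition t)) (fun _ => abs_sin_le_one _)]
  have hVxs : ∀ β r, |r| ≤ 1 → |Vx β * r| ≤ 2 := fun β r hr => by
    rw [abs_mul]; nlinarith [hVxb β, abs_nonneg r, abs_nonneg (Vx β)]
  have hVys : ∀ β r, |r| ≤ 1 → |Vy β * r| ≤ 2 := fun β r hr => by
    rw [abs_mul]; nlinarith [hVyb β, abs_nonneg r, abs_nonneg (Vy β)]
  obtain ⟨α, hα₁, hα₂, hx, hy⟩ : ∃ α, -π < α ∧ α ≤ π ∧ D * cos α = x₁ ∧ D * sin α = y₁ := by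
    have hn : ‖(⟨x₁, y₁⟩ : ℂ)‖ = D := by
      rw [Complex.norm_def, Complex.normSq_mk, hDdef]; ring_nf
    refine ⟨Complex.arg ⟨x₁, y₁⟩, Complex.neg_pi_lt_arg _, Complex.arg_le_pi _, ?_, ?_⟩
    · rw [← hn]; exact Complex.norm_mul_cos_arg _
    · rw [← hn]; exact Complex.norm_mul_sin_arg _
  have hcross : ∀ β, x₁ * sin β - y₁ * cos β = D * sin (β - α) := fun β => by
    rw [← hx, ← hy, sin_sub]; ring
  have hdot : ∀ β, x₁ * cos β + y₁ * sin β = D * cos (β - α) := fun β => by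
    rw [← hx, ← hy, cos_sub]; ring
  obtain ⟨β, hβ, hβ0⟩ : ∃ β ∈ Icc (α - π / 2) (α + π / 2),
      (x₁ - Vx β) * sin β - (y₁ - Vy β) * cos β = 0 := by
    have hg : ContinuousOn (fun β => (x₁ - Vx β) * sin β - (y₁ - Vy β) * cos β)
        (Icc (α - π / 2) (α + π / 2)) := by fun_prop
    have := intermediate_value_Icc (by linarith [pi_pos]) hg
    refine this ⟨?_, ?_⟩
    · have h := hcross (α - π / 2)
      rw [show α - π / 2 - α = -(π / 2) by ring, sin_neg, sin_pi_div_two] at h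
      have h1 := abs_le.1 (hVxs (α - π / 2) _ (abs_sin_le_one (α - π / 2)))
      have h2 := abs_le.1 (hVys (α - π / 2) _ (abs_cos_le_one (α - π / 2)))
      linarith [h1.1, h1.2, h2.1, h2.2]
    · have h := hcross (α + π / 2)
      rw [show α + π / 2 - α = π / 2 by ring, sin_pi_div_two] at h
      have h1 := abs_le.1 (hVxs (α + π / 2) _ (abs_sin_le_one (α + π / 2)))
      have h2 := abs_le.1 (hVys (α + π / 2) _ (abs_cos_le_one (α + π / 2)))
      linarith [h1.1, h1.2, h2.1, h2.2]
  have a1 := abs_le.1 (hVxs β _ (abs_sin_le_one β))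
  have a2 := abs_le.1 (hVys β _ (abs_cos_le_one β))
  have a3 := abs_le.1 (hVxs β _ (abs_cos_le_one β))
  have a4 := abs_le.1 (hVys β _ (abs_sin_le_one β))
  have hc0 : 0 ≤ cos (β - α) :=
    cos_nonneg_of_mem_Icc ⟨by linarith [hβ.1], by linarith [hβ.2]⟩
  have hsq : (D * sin (β - α)) ^ 2 + (D * cos (β - α)) ^ 2 = D ^ 2 := by
    linear_combination D ^ 2 * sin_sq_add_cos_sq (β - α)
  have hDs : |D * sin (β - α)| ≤ 4 := by
    rw [abs_le]
    constructor <;> linarith [hcross β, a1.1, a1.2, a2.1, a2.2]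
  have hDc : 6 ≤ D * cos (β - α) := by
    have h4 : (D * sin (β - α)) ^ 2 ≤ 16 := by
      rw [← sq_abs]; nlinarith [abs_nonneg (D * sin (β - α))]
    have h5 : 0 ≤ D * cos (β - α) := by positivity
    nlinarith
  have hDc' : D * cos (β - α) ≤ D := by
    nlinarith [cos_le_one (β - α)]
  refine ⟨β, (x₁ - Vx β) * cos β + (y₁ - Vy β) * sin β, ?_, ?_, ?_, ?_, ?_⟩
  · rw [abs_le]
    constructor <;> linarith [hβ.1, hβ.2, pi_pos]
  · linarith [hdot β, a3.2, a4.2]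
  · linarith [hdot β, a3.1, a4.1]
  · have : Vx β + ((x₁ - Vx β) * cos β + (y₁ - Vy β) * sin β) * cos β = x₁ := by
      linear_combination (x₁ - Vx β) * sin_sq_add_cos_sq β - sin β * hβ0
    rw [hVx] at this ⊢
    linarith
  · have : Vy β + ((x₁ - Vx β) * cos β + (y₁ - Vy β) * sin β) * sin β = y₁ := by
      linear_combination (y₁ - Vy β) * sin_sq_add_cos_sq β + cos β * hβ0
    rw [hVy] at this ⊢
    linarith

lemma exists_connects_cost_le {φ ψ : ℝ → ℝ} (hφ : Continuous φ) (hψ : Continuous ψ)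
    (hφ0 : φ 0 = 0) (hψ0 : ψ 0 = 0) {p : ℝ} (hp : 0 ≤ p) :
    ∃ K : ℝ, 0 ≤ K ∧ ∀ x₁ y₁ θ₁ : ℝ, 8 ≤ √(x₁ ^ 2 + y₁ ^ 2) →
      ∃ (x y θ κ u : ℝ → ℝ) (T : ℝ), Connects p x y θ κ u T Xinit (x₁, y₁, θ₁, 0) ∧
        cost φ ψ κ u T ≤ √(x₁ ^ 2 + y₁ ^ 2) + K := by
  have hS : Continuous smoothTransition := smoothTransition.continuous
  have hS1 : Continuous (deriv smoothTransition) := contDiff_deriv_smoothTransition.continuous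
  have hS2 := continuous_deriv_deriv_smoothTransition
  obtain ⟨B, hB⟩ : ∃ B : ℝ, ∀ a ∈ Icc (-(4 * π)) (4 * π), ∀ t ∈ Icc (0:ℝ) 1,
      1 + φ (a * deriv smoothTransition t) + ψ (a * deriv (deriv smoothTransition) t) ≤ B := by
    obtain ⟨B, hB⟩ := ((isCompact_Icc (a := -(4 * π)) (b := 4 * π)).prod
      (isCompact_Icc (a := (0:ℝ)) (b := 1))).bddAbove_image
      (f := fun q : ℝ × ℝ => 1 + φ (q.1 * deriv smoothTransition q.2)
        + ψ (q.1 * deriv (deriv smoothTransition) q.2)) (by fun_prop)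
    exact ⟨B, fun a ha t ht => hB ⟨(a, t), ⟨ha, ht⟩, rfl⟩⟩
  refine ⟨4 + 2 * |B|, by positivity, fun x₁ y₁ θ₁ hD => ?_⟩
  set c := toIcoMod two_pi_pos 0 θ₁ with hc
  have hcI : c ∈ Ico 0 (0 + 2 * π) := toIcoMod_mem_Ico two_pi_pos 0 θ₁
  have hcθ : c = θ₁ + 2 * π * ((-toIcoDiv two_pi_pos 0 θ₁ : ℤ) : ℝ) := by
    rw [hc, ← self_sub_toIcoDiv_zsmul two_pi_pos 0 θ₁, zsmul_eq_mul]; push_cast; ring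
  obtain ⟨β, ℓ, hβ, hℓ0, hℓD, hx, hy⟩ := exists_heading x₁ y₁ c hD
  have hβ' := abs_le.1 hβ
  set a := β - π / 2 with ha
  set b := c - β with hb
  have hπ := pi_pos
  have haI : a ∈ Icc (-(4 * π)) (4 * π) := ⟨by linarith [hβ'.1], by linarith [hβ'.2]⟩
  have hbI : b ∈ Icc (-(4 * π)) (4 * π) :=
    ⟨by linarith [hβ'.2, hcI.1], by linarith [hβ'.1, hcI.2]⟩
  set θ : ℝ → ℝ := fun t => π / 2 + a * smoothTransition t + b * smoothTransition (t - (1 + ℓ))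
    with hθ
  set κ : ℝ → ℝ := fun t => a * deriv smoothTransition t + b * deriv smoothTransition (t - (1 + ℓ))
    with hκ
  set u : ℝ → ℝ := fun t => a * deriv (deriv smoothTransition) t
    + b * deriv (deriv smoothTransition) (t - (1 + ℓ)) with hu
  have hθc : Continuous θ := by fun_prop
  have hκc : Continuous κ := by fun_prop
  have huc : Continuous u := by fun_prop
  have hθd : ∀ t, HasDerivAt θ (κ t) t := fun t => by
    have h1 := (hasDerivAt_smoothTransition t).const_mul a
    have h2 := ((hasDerivAt_smoothTransition (t - (1 + ℓ))).comp_sub_const t (1 + ℓ)).const_mul b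
    exact (h1.const_add (π / 2)).add h2
  have hκd : ∀ t, HasDerivAt κ (u t) t := fun t => by
    have h1 := (hasDerivAt_deriv_smoothTransition t).const_mul a
    have h2 := ((hasDerivAt_deriv_smoothTransition (t - (1 + ℓ))).comp_sub_const t
      (1 + ℓ)).const_mul b
    exact h1.add h2
  have e1 : ∀ t ∈ Ioo (0:ℝ) 1, t - (1 + ℓ) < 0 := fun t ht => by linarith [ht.2]
  have e2 : ∀ t ∈ Ioo 1 (1 + ℓ), t - (1 + ℓ) < 0 := fun t ht => by linarith [ht.2]
  have e3 : ∀ t ∈ Ioo (1 + ℓ) (2 + ℓ), 1 < t := fun t ht => by linarith [ht.1]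
  have hθ1 : ∀ t ∈ Ioo (0:ℝ) 1, θ t = π / 2 + a * smoothTransition t := fun t ht => by
    simp only [hθ, smoothTransition.zero_of_nonpos (e1 t ht).le]; ring
  have hθ2 : ∀ t ∈ Ioo 1 (1 + ℓ), θ t = β := fun t ht => by
    simp only [hθ, smoothTransition.zero_of_nonpos (e2 t ht).le,
      smoothTransition.one_of_one_le ht.1.le, ha]; ring
  have hθ3 : ∀ t ∈ Ioo (1 + ℓ) (2 + ℓ), θ t = β + b * smoothTransition (t - (1 + ℓ)) :=
    fun t ht => by simp only [hθ, smoothTransition.one_of_one_le (e3 t ht).le, ha]; ring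
  have hdisp : ∀ F : ℝ → ℝ, Continuous F → ∫ t in (0:ℝ)..(2 + ℓ), F (θ t) =
      (∫ t in (0:ℝ)..1, F (π / 2 + a * smoothTransition t)) + ℓ * F β
        + ∫ t in (0:ℝ)..1, F (β + b * smoothTransition t) := fun F hF =>
    integral_eq_of_three_pieces (f := fun t => F (θ t))
      (g := fun t => F (π / 2 + a * smoothTransition t))
      (h := fun t => F (β + b * smoothTransition t)) (hF.comp hθc) hℓ0
      (fun t ht => congrArg F (hθ1 t ht)) (fun t ht => congrArg F (hθ2 t ht))
      (fun t ht => congrArg F (hθ3 t ht))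
  have hcost : cost φ ψ κ u (2 + ℓ) =
      (∫ t in (0:ℝ)..1, (1 + φ (a * deriv smoothTransition t)
        + ψ (a * deriv (deriv smoothTransition) t))) + ℓ * 1
      + ∫ t in (0:ℝ)..1, (1 + φ (b * deriv smoothTransition t)
        + ψ (b * deriv (deriv smoothTransition) t)) := by
    refine integral_eq_of_three_pieces
      (g := fun t => 1 + φ (a * deriv smoothTransition t)
        + ψ (a * deriv (deriv smoothTransition) t))
      (h := fun t => 1 + φ (b * deriv smoothTransition t)
        + ψ (b * deriv (deriv smoothTransition) t)) (by fun_prop) hℓ0 ?_ ?_ ?_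
    · intro t ht
      simp only [hκ, hu, deriv_smoothTransition_eq_zero (Or.inl (e1 t ht).le),
        deriv_deriv_smoothTransition_eq_zero (Or.inl (e1 t ht)), mul_zero, add_zero]
    · intro t ht
      simp only [hκ, hu, deriv_smoothTransition_eq_zero (Or.inl (e2 t ht).le),
        deriv_deriv_smoothTransition_eq_zero (Or.inl (e2 t ht)),
        deriv_smoothTransition_eq_zero (Or.inr ht.1.le),
        deriv_deriv_smoothTransition_eq_zero (Or.inr ht.1), mul_zero, add_zero, hφ0, hψ0]
    · intro t ht
      simp only [hκ, hu, deriv_smoothTransition_eq_zero (Or.inr (e3 t ht).le),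
        deriv_deriv_smoothTransition_eq_zero (Or.inr (e3 t ht)), mul_zero, zero_add]
  have hturn : ∀ a ∈ Icc (-(4 * π)) (4 * π), ∫ t in (0:ℝ)..1,
      (1 + φ (a * deriv smoothTransition t) + ψ (a * deriv (deriv smoothTransition) t)) ≤ |B| := by
    intro a ha
    have h := intervalIntegral.integral_mono_on (μ := volume) (zero_le_one (α := ℝ))
      (f := fun t => 1 + φ (a * deriv smoothTransition t)
        + ψ (a * deriv (deriv smoothTransition) t)) (g := fun _ => |B|)
      ((by fun_prop : Continuous _).intervalIntegrable _ _)
      (continuous_const.intervalIntegrable _ _)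
      (fun t ht => (hB a ha t ht).trans (le_abs_self B))
    simpa using h
  have hS_neg : deriv smoothTransition (-(1 + ℓ)) = 0 :=
    deriv_smoothTransition_eq_zero (Or.inl (by linarith))
  refine ⟨fun t => ∫ s in (0:ℝ)..t, cos (θ s), fun t => ∫ s in (0:ℝ)..t, sin (θ s), θ, κ, u,
    2 + ℓ, ?_, ?_⟩
  · refine ⟨by linarith, huc.measurable, ?_, intervalIntegral.integral_same,
      intervalIntegral.integral_same, ?_, ?_, ?_, ?_, ?_, ?_, ?_, ?_,
      ⟨-toIcoDiv two_pi_pos 0 θ₁, ?_⟩, ?_⟩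
    · exact (huc.abs.rpow_const fun _ => Or.inr hp).continuousOn.integrableOn_Icc
    · have : smoothTransition (-(1 + ℓ)) = 0 := smoothTransition.zero_of_nonpos (by linarith)
      simp only [hθ, zero_sub, this, smoothTransition.zero, Xinit, mul_zero, add_zero]
    · simp only [hκ, zero_sub, hS_neg, deriv_smoothTransition_eq_zero (Or.inl le_rfl), Xinit,
        mul_zero, add_zero]
    · intro t _
      simp only [intervalIntegral.integral_same, zero_add]
    · intro t _
      simp only [intervalIntegral.integral_same, zero_add]
    · intro t _
      rw [intervalIntegral.integral_eq_sub_of_hasDerivAt (fun s _ => hθd s)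
        (hκc.intervalIntegrable _ _)]
      ring
    · intro t _
      rw [intervalIntegral.integral_eq_sub_of_hasDerivAt (fun s _ => hκd s)
        (huc.intervalIntegrable _ _)]
      ring
    · exact (hdisp cos continuous_cos).trans hx
    · exact (hdisp sin continuous_sin).trans hy
    · refine Eq.trans ?_ hcθ
      simp only [hθ, smoothTransition.one_of_one_le (show (1:ℝ) ≤ 2 + ℓ by linarith),
        smoothTransition.one_of_one_le (show (1:ℝ) ≤ 2 + ℓ - (1 + ℓ) by linarith), ha, hb]
      ring
    · simp only [hκ, deriv_smoothTransition_eq_zero (Or.inr (show (1:ℝ) ≤ 2 + ℓ by linarith)),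
        deriv_smoothTransition_eq_zero (Or.inr (show (1:ℝ) ≤ 2 + ℓ - (1 + ℓ) by linarith)),
        mul_zero, add_zero]
  · rw [hcost]
    linarith [hturn a haI, hturn b hbI]

lemma le_deriv_mul_self_of_convexOn {ψ : ℝ → ℝ} (hψ : ConvexOn ℝ univ ψ)
    (hd : Differentiable ℝ ψ) (h0 : ψ 0 = 0) (r : ℝ) : ψ r ≤ deriv ψ r * r := by
  rcases lt_trichotomy r 0 with hr | rfl | hr
  · have h := hψ.deriv_le_slope (mem_univ r) (mem_univ 0) hr (hd r)
    rw [slope_def_field, h0, le_div_iff₀ (by linarith)] at h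
    linarith
  · simp [h0]
  · have h := hψ.slope_le_deriv (mem_univ 0) (mem_univ r) hr (hd r)
    rw [slope_def_field, h0, div_le_iff₀ (by linarith)] at h
    linarith

lemma H3.exists_mul_abs_lt {ψ : ℝ → ℝ} {p C₀ R₀ : ℝ} (h : H3 ψ p C₀ R₀) (M : ℝ) :
    ∃ A > 0, ∀ r, A < |r| → M * |r| < ψ r := by
  obtain ⟨hp, hC, hR, hψ⟩ := h
  have hlim : Filter.Tendsto (fun r : ℝ => C₀ * r ^ (p - 1)) Filter.atTop Filter.atTop :=
    (tendsto_rpow_atTop (by linarith)).const_mul_atTop hC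
  obtain ⟨A, hA⟩ := Filter.eventually_atTop.1 (hlim.eventually_gt_atTop M)
  refine ⟨max A R₀, lt_max_of_lt_right hR, fun r hr => ?_⟩
  have hr₁ : A < |r| := (le_max_left _ _).trans_lt hr
  have hr₂ : R₀ < |r| := (le_max_right _ _).trans_lt hr
  have hpos : 0 < |r| := hR.trans hr₂
  calc M * |r| < C₀ * |r| ^ (p - 1) * |r| := mul_lt_mul_of_pos_right (hA _ hr₁.le) hpos
    _ = C₀ * |r| ^ p := by
      rw [mul_assoc, ← rpow_add_one hpos.ne', sub_add_cancel]
    _ ≤ ψ r := hψ r hr₂.le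

lemma continuousOn_and_sub_eq_of_eq_add_integral {f g : ℝ → ℝ} {T : ℝ} (hT : 0 ≤ T)
    (hg : IntervalIntegrable g volume 0 T)
    (h : ∀ t ∈ Icc (0:ℝ) T, f t = f 0 + ∫ s in (0:ℝ)..t, g s) :
    ContinuousOn f (Icc 0 T) ∧
      ∀ s ∈ Icc (0:ℝ) T, ∀ t ∈ Icc (0:ℝ) T, f t - f s = ∫ r in s..t, g r := by
  constructor
  · have hc := intervalIntegral.continuousOn_primitive_interval' hg left_mem_uIcc
    rw [uIcc_of_le hT] at hc
    exact (continuousOn_const.add hc).congr h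
  · intro s hs t ht
    have hi : ∀ r ∈ Icc (0:ℝ) T, IntervalIntegrable g volume 0 r := fun r hr =>
      hg.mono_set (by rw [uIcc_of_le hT, uIcc_of_le hr.1]; exact Icc_subset_Icc le_rfl hr.2)
    rw [h t ht, h s hs, ← intervalIntegral.integral_interval_sub_left (hi t ht) (hi s hs)]
    ring

lemma norm_le_of_connects {p : ℝ} {x y θ κ u : ℝ → ℝ} {T x₁ y₁ θ₁ : ℝ}
    (hc : Connects p x y θ κ u T Xinit (x₁, y₁, θ₁, 0)) (hθ : ContinuousOn θ (Icc 0 T)) :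
    √(x₁ ^ 2 + y₁ ^ 2) ≤ T := by
  obtain ⟨hT, -, -, hx0, hy0, -, -, hx, hy, -, -, hxT, hyT, -, -⟩ := hc
  set D := √(x₁ ^ 2 + y₁ ^ 2) with hD
  have hD2 : D ^ 2 = x₁ ^ 2 + y₁ ^ 2 := sq_sqrt (by positivity)
  have hDnn : 0 ≤ D := sqrt_nonneg _
  have hcos : IntervalIntegrable (fun t => cos (θ t)) volume 0 T :=
    (continuous_cos.comp_continuousOn hθ).intervalIntegrable_of_Icc hT.le
  have hsin : IntervalIntegrable (fun t => sin (θ t)) volume 0 T :=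
    (continuous_sin.comp_continuousOn hθ).intervalIntegrable_of_Icc hT.le
  have hX : x₁ = ∫ s in (0:ℝ)..T, cos (θ s) := by
    have := hx T ⟨hT.le, le_rfl⟩
    simp only [Xinit] at hx0 hxT
    rwa [hx0, hxT, zero_add] at this
  have hY : y₁ = ∫ s in (0:ℝ)..T, sin (θ s) := by
    have := hy T ⟨hT.le, le_rfl⟩
    simp only [Xinit] at hy0 hyT
    rwa [hy0, hyT, zero_add] at this
  have hint : D ^ 2 = ∫ s in (0:ℝ)..T, (x₁ * cos (θ s) + y₁ * sin (θ s)) := by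
    rw [intervalIntegral.integral_add (hcos.const_mul _) (hsin.const_mul _),
      intervalIntegral.integral_const_mul, intervalIntegral.integral_const_mul, ← hX, ← hY, hD2]
    ring
  have hle : D ^ 2 ≤ D * T := by
    have h := intervalIntegral.integral_mono_on hT.le
      ((hcos.const_mul x₁).add (hsin.const_mul y₁))
      (continuous_const.intervalIntegrable (μ := volume) 0 T) (g := fun _ => D) fun s _ => by
        refine le_sqrt_of_sq_le ?_
        nlinarith [sq_nonneg (x₁ * sin (θ s) - y₁ * cos (θ s)), sin_sq_add_cos_sq (θ s)]
    rw [hint]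
    refine h.trans_eq ?_
    simp [mul_comm]
  rcases hDnn.eq_or_lt with h0 | h0
  · rw [← h0]; exact hT.le
  · nlinarith

lemma abs_le_of_integral_le {φ ψ κ u : ℝ → ℝ} {T K A r₀ ε : ℝ} (hφc : Continuous φ)
    (hφ : ∀ r, 0 ≤ φ r) (hψ : ∀ r, 0 ≤ ψ r) (hA : 0 ≤ A) (hr₀ : 0 ≤ r₀)
    (hψA : ∀ r, |r| ≤ A + ψ r) (hε : 0 < ε) (hφε : ∀ r, r₀ < |r| → ε ≤ φ r)
    (hκc : ContinuousOn κ (Icc 0 T)) (hκ0 : κ 0 = 0)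
    (hκu : ∀ s ∈ Icc (0:ℝ) T, ∀ t ∈ Icc (0:ℝ) T, κ t - κ s = ∫ r in s..t, u r)
    (hui : IntervalIntegrable u volume 0 T)
    (hψi : IntervalIntegrable (fun t => ψ (u t)) volume 0 T)
    (hφK : ∫ t in (0:ℝ)..T, φ (κ t) ≤ K) (hψK : ∫ t in (0:ℝ)..T, ψ (u t) ≤ K)
    {t : ℝ} (ht : t ∈ Icc 0 T) : |κ t| ≤ r₀ + A * (K / ε) + K := by
  have hT : (0:ℝ) ≤ T := ht.1.trans ht.2
  set E := Icc 0 t ∩ {s | |κ s| ≤ r₀} with hE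
  have hsub : Icc 0 t ⊆ Icc 0 T := Icc_subset_Icc le_rfl ht.2
  have hEc : IsCompact E := by
    have hcl : IsClosed E := by
      have := (hκc.mono hsub).abs.preimage_isClosed_of_isClosed isClosed_Icc
        (isClosed_Iic (a := r₀))
      exact this
    exact isCompact_Icc.of_isClosed_subset hcl inter_subset_left
  have hEne : E.Nonempty := ⟨0, ⟨le_rfl, ht.1⟩, by simpa [hκ0] using hr₀⟩
  obtain ⟨a, ⟨haI, haκ⟩, hamax⟩ := hEc.exists_isGreatest hEne
  have hbig : ∀ s ∈ Ioo a t, r₀ < |κ s| := fun s hs => by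
    by_contra! hle
    exact absurd (hamax ⟨⟨haI.1.trans hs.1.le, hs.2.le⟩, hle⟩) (not_le.2 hs.1)
  have hss : uIcc a t ⊆ uIcc 0 T := by
    rw [uIcc_of_le hT, uIcc_of_le haI.2]; exact Icc_subset_Icc haI.1 ht.2
  have hφi : IntervalIntegrable (fun t => φ (κ t)) volume 0 T :=
    (hφc.comp_continuousOn hκc).intervalIntegrable_of_Icc hT
  have h1 : (t - a) * ε ≤ K := by
    have hm := intervalIntegral.integral_mono_on_of_le_Ioo (μ := volume) haI.2
      (f := fun _ => ε) (continuous_const.intervalIntegrable _ _) (hφi.mono_set hss)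
      (fun s hs => hφε _ (hbig s hs))
    have hm' := intervalIntegral.integral_mono_interval (μ := volume) haI.1 haI.2 ht.2
      (Filter.Eventually.of_forall fun s => hφ (κ s)) hφi
    simp only [intervalIntegral.integral_const, smul_eq_mul] at hm
    linarith
  have h2 : |∫ r in a..t, u r| ≤ A * (t - a) + K := by
    have hm' := intervalIntegral.integral_mono_interval (μ := volume) haI.1 haI.2 ht.2
      (Filter.Eventually.of_forall fun s => hψ (u s)) hψi
    have hψi' := hψi.mono_set hss
    have hm := intervalIntegral.integral_mono_on (μ := volume) haI.2 (hui.mono_set hss).abs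
      ((continuous_const (y := A)).intervalIntegrable a t |>.add hψi') (fun s _ => hψA (u s))
    have hi := intervalIntegral.abs_integral_le_integral_abs (f := u) (μ := volume) haI.2
    rw [intervalIntegral.integral_add (continuous_const.intervalIntegrable _ _) hψi'] at hm
    simp only [intervalIntegral.integral_const, smul_eq_mul] at hm
    linarith
  have h3 : t - a ≤ K / ε := (le_div_iff₀ hε).2 h1
  have h4 : |κ t| ≤ |κ a| + |∫ r in a..t, u r| := by
    rw [← hκu a (hsub haI) t ht]
    simpa using abs_add_le (κ a) (κ t - κ a)
  have haκ' : |κ a| ≤ r₀ := haκ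
  nlinarith [mul_le_mul_of_nonneg_left h3 hA]

/-- Control of a solution of `p₃' = g`, `p₄' = -p₃ + f` with `|g| ≤ ρ`, `|f| ≤ F`, provided `p₄`
is at most `M` in absolute value somewhere in every window of length `1 / 4`. -/
lemma abs_le_of_windows {p₃ p₄ f : ℝ → ℝ} {T ρ F M : ℝ} (hρ : 0 ≤ ρ) (hF : 0 ≤ F) (hM : 0 ≤ M)
    (hT : 1 < T) (hp₃c : ContinuousOn p₃ (Icc 0 T)) (hfc : ContinuousOn f (Icc 0 T))
    (hf : ∀ t ∈ Icc 0 T, |f t| ≤ F)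
    (hp₃ : ∀ s ∈ Icc (0:ℝ) T, ∀ t ∈ Icc (0:ℝ) T, |p₃ t - p₃ s| ≤ ρ * |t - s|)
    (hp₄ : ∀ s ∈ Icc (0:ℝ) T, ∀ t ∈ Icc (0:ℝ) T, p₄ t - p₄ s = ∫ r in s..t, (-(p₃ r) + f r))
    (hwin : ∀ a, 0 ≤ a → a + 1 / 4 ≤ T → ∃ s ∈ Icc a (a + 1 / 4), |p₄ s| ≤ M)
    {t : ℝ} (ht : t ∈ Icc 0 T) :
    |p₃ t| ≤ 4 * M + 2 * F + 2 * ρ ∧ |p₄ t| ≤ 5 * M + 3 * F + 3 * ρ := by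
  obtain ⟨c, hc0, hcT, hct⟩ : ∃ c, 0 ≤ c ∧ c + 1 ≤ T ∧ t ∈ Icc c (c + 1) := by
    rcases le_total t (T - 1) with h | h
    · exact ⟨t, ht.1, by linarith, le_rfl, by linarith⟩
    · exact ⟨T - 1, by linarith, by linarith, h, by linarith [ht.2]⟩
  have hW : Icc c (c + 1) ⊆ Icc 0 T := Icc_subset_Icc hc0 hcT
  obtain ⟨s₁, hs₁, hs₁M⟩ := hwin c hc0 (by linarith)
  obtain ⟨s₂, hs₂, hs₂M⟩ := hwin (c + 3 / 4) (by linarith) (by linarith)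
  have hs₁W : s₁ ∈ Icc c (c + 1) := ⟨hs₁.1, by linarith [hs₁.2]⟩
  have hs₂W : s₂ ∈ Icc c (c + 1) := ⟨by linarith [hs₂.1], by linarith [hs₂.2]⟩
  have hgap : 1 / 2 ≤ s₂ - s₁ := by linarith [hs₁.2, hs₂.1]
  have hgap' : s₂ - s₁ ≤ 1 := by linarith [hs₁.1, hs₂.2]
  have hosc : ∀ r ∈ Icc c (c + 1), |p₃ r - p₃ t| ≤ ρ := fun r hr => by
    refine (hp₃ t ht r (hW hr)).trans (mul_le_of_le_one_right hρ ?_)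
    rw [abs_le]
    constructor <;> linarith [hr.1, hr.2, hct.1, hct.2]
  have hsubI : ∀ {a b}, a ∈ Icc c (c + 1) → b ∈ Icc c (c + 1) → uIcc a b ⊆ Icc c (c + 1) :=
    fun ha hb => uIcc_subset_Icc ha hb
  have hbound : ∀ a ∈ Icc c (c + 1), ∀ b ∈ Icc c (c + 1),
      |(p₄ b - p₄ a) + (b - a) * p₃ t| ≤ (ρ + F) * |b - a| := by
    intro a ha b hb
    have hi : IntervalIntegrable (fun r => -(p₃ r) + f r) volume a b :=
      ((hp₃c.neg.add hfc).mono ((hsubI ha hb).trans hW)).intervalIntegrable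
    have heq : (p₄ b - p₄ a) + (b - a) * p₃ t = ∫ r in a..b, (-(p₃ r) + f r + p₃ t) := by
      rw [intervalIntegral.integral_add hi (continuous_const.intervalIntegrable _ _),
        ← hp₄ a (hW ha) b (hW hb)]
      simp
    rw [heq]
    refine intervalIntegral.norm_integral_le_of_norm_le_const (E := ℝ) fun r hr => ?_
    have hrW := hsubI ha hb (uIoc_subset_uIcc hr)
    have e1 := abs_le.1 (hosc r hrW)
    have e2 := abs_le.1 (hf r (hW hrW))
    rw [norm_eq_abs, abs_le]
    constructor <;> linarith [e1.1, e1.2, e2.1, e2.2]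
  have h3 : |p₃ t| ≤ 4 * M + 2 * F + 2 * ρ := by
    have hb := hbound s₁ hs₁W s₂ hs₂W
    rw [abs_of_nonneg (by linarith : 0 ≤ s₂ - s₁)] at hb
    have h12 : |p₄ s₂ - p₄ s₁| ≤ 2 * M := (abs_sub _ _).trans (by linarith)
    have hm : (s₂ - s₁) * |p₃ t| ≤ 2 * M + (ρ + F) * (s₂ - s₁) := by
      rw [← abs_of_nonneg (by linarith : 0 ≤ s₂ - s₁), ← abs_mul,
        abs_of_nonneg (by linarith : 0 ≤ s₂ - s₁)]
      calc |(s₂ - s₁) * p₃ t| = |(p₄ s₂ - p₄ s₁ + (s₂ - s₁) * p₃ t) - (p₄ s₂ - p₄ s₁)| := by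
            congr 1; ring
        _ ≤ _ := (abs_sub _ _).trans (by linarith)
    nlinarith [abs_nonneg (p₃ t)]
  refine ⟨h3, ?_⟩
  have hb := hbound s₁ hs₁W t hct
  have htl : |t - s₁| ≤ 1 := by
    rw [abs_le]
    constructor <;> linarith [hs₁.1, hs₁.2, hct.1, hct.2]
  have hq : |(t - s₁) * p₃ t| ≤ |p₃ t| := by
    rw [abs_mul]; exact mul_le_of_le_one_left (abs_nonneg _) htl
  have hq' : (ρ + F) * |t - s₁| ≤ ρ + F := mul_le_of_le_one_right (by linarith) htl
  have hfin : |p₄ t| ≤ |p₄ t - p₄ s₁ + (t - s₁) * p₃ t| + |(t - s₁) * p₃ t| + |p₄ s₁| := by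
    have e1 := abs_sub (p₄ t - p₄ s₁ + (t - s₁) * p₃ t) ((t - s₁) * p₃ t)
    have e2 := abs_add_le (p₄ t - p₄ s₁) (p₄ s₁)
    rw [add_sub_cancel_right] at e1
    rw [sub_add_cancel] at e2
    linarith
  linarith

lemma exists_abs_deriv_le {φ ψ : ℝ → ℝ} {K A : ℝ} (hφ2 : ContDiff ℝ 2 φ)
    (hφ : ∀ r, 0 ≤ φ r) (hψ : ∀ r, 0 ≤ ψ r) (hφe : ∀ r, φ (-r) = φ r)
    (hφm : MonotoneOn φ (Ici 0)) (hA : 0 ≤ A) (hψA : ∀ r, |r| ≤ A + ψ r) :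
    ∃ F, 0 ≤ F ∧ ∀ (κ u : ℝ → ℝ) (T : ℝ), ContinuousOn κ (Icc 0 T) → κ 0 = 0 →
      (∀ s ∈ Icc (0:ℝ) T, ∀ t ∈ Icc (0:ℝ) T, κ t - κ s = ∫ r in s..t, u r) →
      IntervalIntegrable u volume 0 T → IntervalIntegrable (fun t => ψ (u t)) volume 0 T →
      ∫ t in (0:ℝ)..T, φ (κ t) ≤ K → ∫ t in (0:ℝ)..T, ψ (u t) ≤ K →
      ∀ t ∈ Icc 0 T, |deriv φ (κ t)| ≤ F := by
  have hd : Continuous (deriv φ) := hφ2.continuous_deriv one_le_two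
  by_cases hz : ∀ r, φ r = 0
  · refine ⟨0, le_rfl, fun κ u T _ _ _ _ _ _ _ t _ => ?_⟩
    rw [funext hz]
    simp
  · push Not at hz
    obtain ⟨r, hr⟩ := hz
    have hε : 0 < φ r := (hφ r).lt_of_ne' hr
    have heven : ∀ s, φ |s| = φ s := fun s => by
      rcases abs_choice s with h | h <;> rw [h]
      exact hφe s
    have hφε : ∀ s, |r| < |s| → φ r ≤ φ s := fun s hs => by
      rw [← heven r, ← heven s]
      exact hφm (abs_nonneg r) (abs_nonneg s) hs.le
    set B := |r| + A * (K / φ r) + K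
    obtain ⟨F, hF⟩ := isCompact_Icc.exists_bound_of_continuousOn
      (hd.continuousOn (s := Icc (-B) B))
    refine ⟨|F|, abs_nonneg F, fun κ u T hκc hκ0 hκu hui hψi hφK hψK t ht => ?_⟩
    have := abs_le_of_integral_le hφ2.continuous hφ hψ hA (abs_nonneg r) hψA hε hφε hκc hκ0 hκu
      hui hψi hφK hψK ht
    exact (hF _ (abs_le.1 this)).trans (le_abs_self F)

/-- uniform bound `‖(p₃,p₄)‖_∞ ≤ C(1+ρ)` for the adjoint
components along optimal trajectories with large final time. -/
theorem adjoint_linfty_bound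
    (φ ψ : ℝ → ℝ) (p C₀ R₀ : ℝ)
    (h1 : H1 φ ψ) (h2 : H2 ψ) (h3 : H3 ψ p C₀ R₀) :
    ∃ C > (0:ℝ), ∃ T₀ > (0:ℝ),
      ∀ (x₁ y₁ θ₁ : ℝ), 8 * Real.sqrt π ≤ Real.sqrt (x₁^2 + y₁^2) →
      ∀ (x y θ κ u : ℝ → ℝ) (T ρ φh : ℝ) (p₃ p₄ : ℝ → ℝ),
        T₀ < T →
        IsOptimal φ ψ p x y θ κ u T Xinit (x₁, y₁, θ₁, 0) →
        PMPData φ ψ θ κ u T ρ φh p₃ p₄ →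
        ∀ t ∈ Set.Icc (0:ℝ) T, max |p₃ t| |p₄ t| ≤ C * (1 + ρ) := by
  obtain ⟨hφ, hψ, hφ2, hψ2, hφe, -, hφm, -, hφ0, hψ0⟩ := h1
  have hψd : Differentiable ℝ ψ := hψ2.differentiable two_ne_zero
  have hψ' : Continuous (deriv ψ) := hψ2.continuous_deriv one_le_two
  have hφ' : Continuous (deriv φ) := hφ2.continuous_deriv one_le_two
  have htan := le_deriv_mul_self_of_convexOn h2.1.convexOn hψd hψ0
  obtain ⟨K, hK0, hK⟩ := exists_connects_cost_le hφ2.continuous hψ2.continuous hφ0 hψ0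
    (zero_le_one.trans h3.1.le)
  obtain ⟨A, hA, hA'⟩ := h3.exists_mul_abs_lt 1
  have hψA : ∀ r, |r| ≤ A + ψ r := fun r => by
    rcases le_or_gt |r| A with h | h
    · linarith [hψ r]
    · linarith [hA' r h]
  obtain ⟨F, hF0, hF⟩ := exists_abs_deriv_le (K := K) hφ2 hφ hψ hφe hφm hA.le hψA
  obtain ⟨M, hM⟩ := isCompact_Icc.exists_bound_of_continuousOn
    (hψ'.continuousOn (s := Icc (-(A + (4 * K + 4))) (A + (4 * K + 4))))
  have hMψ : ∀ r, |M| < |deriv ψ r| → 4 * K + 4 ≤ ψ r := fun r hr => by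
    by_contra! hlt
    have := hM r (abs_le.1 ((hψA r).trans (by linarith)))
    exact absurd (this.trans (le_abs_self M)) (not_le.2 hr)
  refine ⟨5 * |M| + 3 * F + 3, by positivity, 1, one_pos, ?_⟩
  intro x₁ y₁ θ₁ hD x y θ κ u T ρ φh p₃ p₄ hT hopt hpmp t ht
  obtain ⟨hρ, -, hp₃, hp₄, hu, -⟩ := hpmp
  obtain ⟨hconn, hmin⟩ := hopt
  have hT0 : 0 ≤ T := zero_le_one.trans hT.le
  obtain ⟨-, hum, hup, -, -, -, hκ0, -, -, hθ, hκ, -, -, -, -⟩ := id hconn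
  have hκ0 : κ 0 = 0 := hκ0
  have hui : IntervalIntegrable u volume 0 T := by
    rw [intervalIntegrable_iff_integrableOn_Icc_of_le hT0]
    refine ((integrable_const (1:ℝ)).add hup).mono' hum.aestronglyMeasurable
      (Filter.Eventually.of_forall fun s => ?_)
    have hnn : 0 ≤ |u s| ^ p := rpow_nonneg (abs_nonneg _) _
    simp only [Pi.add_apply, norm_eq_abs]
    rcases le_total |u s| 1 with h | h
    · linarith
    · linarith [self_le_rpow_of_one_le h h3.1.le]
  obtain ⟨hκc, hκu⟩ := continuousOn_and_sub_eq_of_eq_add_integral hT0 hui hκ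
  obtain ⟨hθc, -⟩ := continuousOn_and_sub_eq_of_eq_add_integral hT0
    (hκc.intervalIntegrable_of_Icc hT0) hθ
  have hsinc : ContinuousOn (fun s => ρ * sin (θ s - φh)) (Icc 0 T) := by fun_prop
  obtain ⟨hp₃c, hp₃'⟩ := continuousOn_and_sub_eq_of_eq_add_integral hT0
    (hsinc.intervalIntegrable_of_Icc hT0) hp₃
  have hφκ : ContinuousOn (fun s => deriv φ (κ s)) (Icc 0 T) := hφ'.comp_continuousOn hκc
  obtain ⟨hp₄c, hp₄'⟩ := continuousOn_and_sub_eq_of_eq_add_integral hT0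
    ((hp₃c.neg.add hφκ).intervalIntegrable_of_Icc hT0) hp₄
  have hψi : IntervalIntegrable (fun s => ψ (u s)) volume 0 T := by
    obtain ⟨P, hP⟩ := isCompact_Icc.exists_bound_of_continuousOn hp₄c
    obtain ⟨R, -, hR⟩ := h3.exists_mul_abs_lt P
    rw [intervalIntegrable_iff_integrableOn_Icc_of_le hT0]
    refine (integrable_const (P * R)).mono'
      (hψ2.continuous.measurable.comp hum).aestronglyMeasurable ?_
    filter_upwards [hu, ae_restrict_mem measurableSet_Icc] with s hs hsI
    have hPs : |deriv ψ (u s)| ≤ P := by rw [hs]; exact hP s hsI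
    have hle : ψ (u s) ≤ P * |u s| := (htan (u s)).trans <| (le_abs_self _).trans <| by
      rw [abs_mul]; gcongr
    have huR : |u s| ≤ R := by
      by_contra! h
      exact absurd hle (not_le.2 (hR _ h))
    rw [norm_eq_abs, abs_of_nonneg (hψ _)]
    exact hle.trans (mul_le_mul_of_nonneg_left huR ((abs_nonneg _).trans hPs))
  have hφi : IntervalIntegrable (fun s => φ (κ s)) volume 0 T :=
    (hφ2.continuous.comp_continuousOn hκc).intervalIntegrable_of_Icc hT0
  have hsum : (∫ s in (0:ℝ)..T, φ (κ s)) + ∫ s in (0:ℝ)..T, ψ (u s) ≤ K := by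
    have h8 : 8 ≤ √(x₁ ^ 2 + y₁ ^ 2) := by
      have : 1 ≤ √π := one_le_sqrt.2 (by linarith [pi_gt_three])
      linarith
    obtain ⟨x', y', θ', κ', u', T', hc', hcost'⟩ := hK x₁ y₁ θ₁ h8
    have hle := (hmin x' y' θ' κ' u' T' hc').trans hcost'
    have hci : IntervalIntegrable (fun _ : ℝ => (1:ℝ)) volume 0 T :=
      continuous_const.intervalIntegrable _ _
    rw [cost, intervalIntegral.integral_add (hci.add hφi) hψi,
      intervalIntegral.integral_add hci hφi, intervalIntegral.integral_const, smul_eq_mul] at hle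
    linarith [norm_le_of_connects hconn hθc]
  have hφK : ∫ s in (0:ℝ)..T, φ (κ s) ≤ K := by
    linarith [intervalIntegral.integral_nonneg (μ := volume) hT0 fun s _ => hψ (u s)]
  have hψK : ∫ s in (0:ℝ)..T, ψ (u s) ≤ K := by
    linarith [intervalIntegral.integral_nonneg (μ := volume) hT0 fun s _ => hφ (κ s)]
  have hwin : ∀ a, 0 ≤ a → a + 1 / 4 ≤ T → ∃ s ∈ Icc a (a + 1 / 4), |p₄ s| ≤ |M| := by
    intro a ha haT
    by_contra! hlt
    have hsub : Icc a (a + 1 / 4) ⊆ Icc 0 T := Icc_subset_Icc ha haT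
    have hae : (fun _ => 4 * K + 4) ≤ᵐ[volume.restrict (Icc a (a + 1 / 4))]
        fun s => ψ (u s) := by
      filter_upwards [ae_restrict_of_ae_restrict_of_subset hsub hu,
        ae_restrict_mem measurableSet_Icc] with s hs hsI
      exact hMψ _ (by rw [hs]; exact hlt s hsI)
    have hm := intervalIntegral.integral_mono_ae_restrict (by linarith : a ≤ a + 1 / 4)
      (continuous_const.intervalIntegrable _ _) (hψi.mono_set (by
        rw [uIcc_of_le hT0, uIcc_of_le (by linarith)]; exact hsub)) hae
    have hm' := intervalIntegral.integral_mono_interval (μ := volume) ha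
      (by linarith : a ≤ a + 1 / 4) haT (Filter.Eventually.of_forall fun s => hψ (u s)) hψi
    simp only [intervalIntegral.integral_const, smul_eq_mul] at hm
    linarith
  have hp₃lip : ∀ s ∈ Icc (0:ℝ) T, ∀ t ∈ Icc (0:ℝ) T, |p₃ t - p₃ s| ≤ ρ * |t - s| := by
    intro s hs t ht
    rw [hp₃' s hs t ht]
    refine intervalIntegral.norm_integral_le_of_norm_le_const (E := ℝ) fun r _ => ?_
    rw [norm_eq_abs, abs_mul, abs_of_pos hρ]
    exact mul_le_of_le_one_right hρ.le (abs_sin_le_one _)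
  obtain ⟨hb₃, hb₄⟩ := abs_le_of_windows hρ.le hF0 (abs_nonneg M) hT hp₃c hφκ
    (hF κ u T hκc hκ0 hκu hui hψi hφK hψK) hp₃lip hp₄' hwin ht
  have hM0 := abs_nonneg M
  have hMρ : 0 ≤ |M| * ρ := by positivity
  have hFρ : 0 ≤ F * ρ := by positivity
  exact max_le (by linarith) (by linarith)


end
end
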